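/- arXiv:1004.3964 — 3 statements merged into one kernel-verified Lean document; each statement's English description precedes it below -/
import Mathlib

section
/- The number of simsun permutations in S_n equals the Euler number E_{n+1}, i.e., the number of alternating permutations of length n+1. -/
/-- A permutation `σ ∈ S_n` is *simsun* if for every `k`, the subword of `σ`
restricted to the `k` smallest values has no double descent, i.e. no three
consecutive (in that subword) decreasing elements. -/
def Simsun {n : ℕ} (σ : Equiv.Perm (Fin n)) : Prop :=
  ∀ k : ℕ, ¬ ∃ i j l : Fin n, i < j ∧ j < l ∧
    (σ i).val < k ∧ (σ j).val < k ∧ (σ l).val < k ∧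
    σ l < σ j ∧ σ j < σ i ∧
    (∀ m : Fin n, i < m → m < j → k ≤ (σ m).val) ∧
    (∀ m : Fin n, j < m → m < l → k ≤ (σ m).val)

def DoubleSimsun {n : ℕ} (σ : Equiv.Perm (Fin n)) : Prop :=
  Simsun σ ∧ Simsun σ⁻¹

def Avoids123 {n : ℕ} (σ : Equiv.Perm (Fin n)) : Prop :=
  ¬ ∃ i j k : Fin n, i < j ∧ j < k ∧ σ i < σ j ∧ σ j < σ k

def Avoids132 {n : ℕ} (σ : Equiv.Perm (Fin n)) : Prop :=
  ¬ ∃ i j k : Fin n, i < j ∧ j < k ∧ σ i < σ k ∧ σ k < σ j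

def Avoids213 {n : ℕ} (σ : Equiv.Perm (Fin n)) : Prop :=
  ¬ ∃ i j k : Fin n, i < j ∧ j < k ∧ σ j < σ i ∧ σ i < σ k

def Avoids231 {n : ℕ} (σ : Equiv.Perm (Fin n)) : Prop :=
  ¬ ∃ i j k : Fin n, i < j ∧ j < k ∧ σ k < σ i ∧ σ i < σ j

def Avoids312 {n : ℕ} (σ : Equiv.Perm (Fin n)) : Prop :=
  ¬ ∃ i j k : Fin n, i < j ∧ j < k ∧ σ j < σ k ∧ σ k < σ i

def Avoids321 {n : ℕ} (σ : Equiv.Perm (Fin n)) : Prop :=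
  ¬ ∃ i j k : Fin n, i < j ∧ j < k ∧ σ k < σ j ∧ σ j < σ i

/-- An occurrence of the pattern 4132 at positions `i1 < i2 < i3 < i4`. -/
def Pattern4132At {n : ℕ} (σ : Equiv.Perm (Fin n)) (i1 i2 i3 i4 : Fin n) : Prop :=
  i1 < i2 ∧ i2 < i3 ∧ i3 < i4 ∧ σ i2 < σ i4 ∧ σ i4 < σ i3 ∧ σ i3 < σ i1

/-- An occurrence of the pattern 51342 at positions `j1 < j2 < j3 < j4 < j5`. -/
def Pattern51342At {n : ℕ} (σ : Equiv.Perm (Fin n)) (j1 j2 j3 j4 j5 : Fin n) : Prop :=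
  j1 < j2 ∧ j2 < j3 ∧ j3 < j4 ∧ j4 < j5 ∧
  σ j2 < σ j5 ∧ σ j5 < σ j3 ∧ σ j3 < σ j4 ∧ σ j4 < σ j1

/-- `σ` has no occurrence of the pattern 4132. -/
def No4132 {n : ℕ} (σ : Equiv.Perm (Fin n)) : Prop :=
  ¬ ∃ i1 i2 i3 i4 : Fin n, Pattern4132At σ i1 i2 i3 i4

/-- Every occurrence of the pattern 4132 in `σ` is contained in an occurrence
of the pattern 51342 (its four indices are among the five indices). -/
def Every4132In51342 {n : ℕ} (σ : Equiv.Perm (Fin n)) : Prop :=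
  ∀ i1 i2 i3 i4 : Fin n, Pattern4132At σ i1 i2 i3 i4 →
    ∃ j1 j2 j3 j4 j5 : Fin n, Pattern51342At σ j1 j2 j3 j4 j5 ∧
      ({i1, i2, i3, i4} : Set (Fin n)) ⊆ ({j1, j2, j3, j4, j5} : Set (Fin n))

def Contains35142 {n : ℕ} (σ : Equiv.Perm (Fin n)) : Prop :=
  ∃ i1 i2 i3 i4 i5 : Fin n, i1 < i2 ∧ i2 < i3 ∧ i3 < i4 ∧ i4 < i5 ∧
    σ i3 < σ i5 ∧ σ i5 < σ i1 ∧ σ i1 < σ i4 ∧ σ i4 < σ i2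

def Contains42513 {n : ℕ} (σ : Equiv.Perm (Fin n)) : Prop :=
  ∃ i1 i2 i3 i4 i5 : Fin n, i1 < i2 ∧ i2 < i3 ∧ i3 < i4 ∧ i4 < i5 ∧
    σ i4 < σ i2 ∧ σ i2 < σ i5 ∧ σ i5 < σ i1 ∧ σ i1 < σ i3

/-- A Motzkin path encoded as a list of steps `1` (up), `-1` (down), `0` (level):
all prefix sums are nonnegative and the total sum is zero. -/
def MotzkinPath (p : List ℤ) : Prop :=
  (∀ s ∈ p, s = 1 ∨ s = -1 ∨ s = 0) ∧ (∀ t : List ℤ, t <+: p → 0 ≤ t.sum) ∧ p.sum = 0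

/-- The path has no two consecutive up steps. -/
def UUFree (p : List ℤ) : Prop := ¬ ([1, 1] : List ℤ) <:+: p

-- The number of descents of a permutation
open scoped Classical in
noncomputable def numDescents {n : ℕ} (σ : Equiv.Perm (Fin n)) : ℕ :=
  (Finset.univ.filter fun i : Fin n =>
    ∃ h : i.val + 1 < n, σ ⟨i.val + 1, h⟩ < σ i).card

/-- `τ_1 > τ_2 < τ_3 > τ_4 < ⋯` (indices are 0-based here). -/
def Alternating {m : ℕ} (τ : Equiv.Perm (Fin m)) : Prop :=
  ∀ i : Fin m, ∀ h : i.val + 1 < m,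
    if i.val % 2 = 0 then τ ⟨i.val + 1, h⟩ < τ i else τ i < τ ⟨i.val + 1, h⟩

open PowerSeries in
theorem PowerSeries.derivative_sin_rat : d⁄dX ℚ (PowerSeries.sin ℚ) = PowerSeries.cos ℚ := by
  ext n
  rw [coeff_derivative]
  have : (n : ℚ) + 1 ≠ 0 := by positivity
  rcases Nat.even_or_odd' n with ⟨k, rfl | rfl⟩
  · have h1 : ¬ Even (2 * k + 1) := by simp
    have h2 : (2 * k + 1) / 2 = k := by omega
    simp [PowerSeries.sin, PowerSeries.cos, h2, Nat.factorial_succ]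
    field_simp
  · have h1 : Even (2 * k + 1 + 1) := by simp [parity_simps]
    simp [PowerSeries.sin, PowerSeries.cos, h1]

open PowerSeries in
theorem PowerSeries.derivative_cos_rat : d⁄dX ℚ (PowerSeries.cos ℚ) = -PowerSeries.sin ℚ := by
  ext n
  rw [coeff_derivative]
  have : (n : ℚ) + 1 ≠ 0 := by positivity
  rcases Nat.even_or_odd' n with ⟨k, rfl | rfl⟩
  · simp [PowerSeries.sin, PowerSeries.cos]
  · have h1 : Even (2 * k + 1 + 1) := by simp [parity_simps]
    have h2 : (2 * k + 1) / 2 = k := by omega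
    have h3 : (2 * k + 1 + 1) / 2 = k + 1 := by omega
    simp [PowerSeries.sin, PowerSeries.cos, h1, h2, h3, Nat.factorial_succ, pow_succ] at this ⊢
    field_simp

open PowerSeries in
theorem PowerSeries.sin_sq_add_cos_sq_rat :
    PowerSeries.sin ℚ ^ 2 + PowerSeries.cos ℚ ^ 2 = 1 := by
  apply PowerSeries.derivative.ext
  · simp only [map_add, PowerSeries.derivative_pow, derivative_sin_rat, derivative_cos_rat,
      derivative_one]
    ring
  · simp [PowerSeries.sin, PowerSeries.cos]

/-- The exponential generating function of a sequence. -/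
noncomputable def expGenFun (u : ℕ → ℚ) : PowerSeries ℚ :=
  PowerSeries.mk fun n => u n / n.factorial

open PowerSeries in
theorem derivative_expGenFun (u : ℕ → ℚ) :
    d⁄dX ℚ (expGenFun u) = expGenFun fun n => u (n + 1) := by
  ext n
  rw [coeff_derivative]
  have : (n : ℚ) + 1 ≠ 0 := by positivity
  simp [expGenFun, Nat.factorial_succ]
  field_simp

open PowerSeries in
theorem constantCoeff_iterate_derivative_expGenFun (u : ℕ → ℚ) (n : ℕ) :
    constantCoeff ((d⁄dX ℚ)^[n] (expGenFun u)) = u n := by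
  rw [constantCoeff_iterate_derivative]
  have : (n.factorial : ℚ) ≠ 0 := by positivity
  simp [expGenFun]
  field_simp

open PowerSeries in
/-- A Seidel–Entringer array has boundary generating function `Y = cos + Y sin`. -/
theorem expGenFun_boundary (a : ℕ → ℕ → ℚ) (h00 : a 0 0 = 1) (h0 : ∀ j, a 0 (j + 1) = 0)
    (ha : ∀ i j, a (i + 1) j = a i (j + 1) + a j i) :
    expGenFun (fun n => a n 0) =
      PowerSeries.cos ℚ + PowerSeries.sin ℚ * expGenFun (fun n => a n 0) := by
  have hF0 : expGenFun (a 0) = 1 := by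
    ext n
    cases n <;> simp [expGenFun, h00, h0, coeff_one]
  have key : ∀ n, (d⁄dX ℚ)^[n] (PowerSeries.cos ℚ + PowerSeries.sin ℚ *
      expGenFun (fun n => a n 0)) = PowerSeries.cos ℚ * expGenFun (a n) +
        PowerSeries.sin ℚ * expGenFun (fun j => a j n) := by
    intro n
    induction n with
    | zero => simp [hF0]
    | succ n ih =>
      rw [Function.iterate_succ_apply', ih]
      have h1 : expGenFun (a (n + 1)) =
          d⁄dX ℚ (expGenFun (a n)) + expGenFun (fun j => a j n) := by
        rw [derivative_expGenFun]
        ext j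
        simp [expGenFun, ha n j, add_div]
      have h2 : expGenFun (fun j => a j (n + 1)) =
          d⁄dX ℚ (expGenFun (fun j => a j n)) - expGenFun (a n) := by
        rw [derivative_expGenFun]
        ext j
        simp [expGenFun, ha j n, add_div]
      rw [h1, h2]
      simp only [map_add, Derivation.leibniz, smul_eq_mul, derivative_sin_rat, derivative_cos_rat]
      ring
  ext n
  have hn : (n.factorial : ℚ) ≠ 0 := by positivity
  apply mul_left_cancel₀ hn
  rw [← constantCoeff_iterate_derivative, ← constantCoeff_iterate_derivative,
    constantCoeff_iterate_derivative_expGenFun, key]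
  simp [PowerSeries.sin, PowerSeries.cos, expGenFun]

open PowerSeries in
theorem two_mul_derivative_expGenFun_boundary (a : ℕ → ℕ → ℚ) (h00 : a 0 0 = 1)
    (h0 : ∀ j, a 0 (j + 1) = 0) (ha : ∀ i j, a (i + 1) j = a i (j + 1) + a j i) :
    2 * d⁄dX ℚ (expGenFun fun n => a n 0) = 1 + expGenFun (fun n => a n 0) ^ 2 := by
  have h := expGenFun_boundary a h00 h0 ha
  set Y := expGenFun fun n => a n 0
  have hd := congrArg (d⁄dX ℚ) h
  simp only [map_add, Derivation.leibniz, smul_eq_mul, derivative_sin_rat,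
    derivative_cos_rat] at hd
  have hs := sin_sq_add_cos_sq_rat
  set S := PowerSeries.sin ℚ
  set C := PowerSeries.cos ℚ
  have hne : 1 - S ≠ 0 := by
    intro h
    have := congrArg (coeff 0) h
    simp [S, PowerSeries.sin] at this
  apply mul_left_cancel₀ (pow_ne_zero 2 hne)
  linear_combination 2 * (1 - S) * hd + 2 * C * h - (Y - S * Y + C) * h + hs

open PowerSeries in
/-- The grammar `x ↦ xy`, `y ↦ x` acting on monomials. -/
theorem iterate_derivative_monomial {X Y : PowerSeries ℚ} (hY : d⁄dX ℚ Y = X)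
    (hX : d⁄dX ℚ X = X * Y) (m a b : ℕ) :
    (d⁄dX ℚ)^[m + 1] (X ^ a * Y ^ b) =
      a • (d⁄dX ℚ)^[m] (X ^ a * Y ^ (b + 1)) + b • (d⁄dX ℚ)^[m] (X ^ (a + 1) * Y ^ (b - 1)) := by
  have h : d⁄dX ℚ (X ^ a * Y ^ b) =
      a • (X ^ a * Y ^ (b + 1)) + b • (X ^ (a + 1) * Y ^ (b - 1)) := by
    simp only [Derivation.leibniz, smul_eq_mul, PowerSeries.derivative_pow, hX, hY, nsmul_eq_mul]
    cases a <;> cases b <;> simp <;> ring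
  rw [Function.iterate_succ_apply, h, iterate_map_add, iterate_map_nsmul, iterate_map_nsmul]

open PowerSeries in
theorem constantCoeff_iterate_derivative_monomial {X Y : PowerSeries ℚ} (hY : d⁄dX ℚ Y = X)
    (hX : d⁄dX ℚ X = X * Y) (m a b : ℕ) :
    constantCoeff ((d⁄dX ℚ)^[m + 1] (X ^ a * Y ^ b)) =
      a * constantCoeff ((d⁄dX ℚ)^[m] (X ^ a * Y ^ (b + 1))) +
        b * constantCoeff ((d⁄dX ℚ)^[m] (X ^ (a + 1) * Y ^ (b - 1))) := by
  rw [iterate_derivative_monomial hY hX]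
  simp

/-- Insert the value `q` at position `p` into a permutation. -/
def Equiv.Perm.insertAt {n : ℕ} (p q : Fin (n + 1)) (τ : Equiv.Perm (Fin n)) :
    Equiv.Perm (Fin (n + 1)) :=
  (finSuccEquiv' p).trans ((Equiv.optionCongr τ).trans (finSuccEquiv' q).symm)

namespace Equiv.Perm

@[simp]
theorem insertAt_self {n : ℕ} (p q : Fin (n + 1)) (τ : Equiv.Perm (Fin n)) :
    insertAt p q τ p = q := by
  simp [insertAt]

@[simp]
theorem insertAt_succAbove {n : ℕ} (p q : Fin (n + 1)) (τ : Equiv.Perm (Fin n)) (k : Fin n) :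
    insertAt p q τ (p.succAbove k) = q.succAbove (τ k) := by
  simp [insertAt]

theorem insertAt_left_inj {n : ℕ} {p q : Fin (n + 1)} {τ τ' : Equiv.Perm (Fin n)} :
    insertAt p q τ = insertAt p q τ' ↔ τ = τ' := by
  refine ⟨fun h => ?_, fun h => h ▸ rfl⟩
  ext k
  have := DFunLike.congr_fun h (p.succAbove k)
  rw [insertAt_succAbove, insertAt_succAbove] at this
  rw [Fin.succAbove_right_injective this]

theorem bijective_insertAt_position {n : ℕ} (p : Fin (n + 1)) :
    Function.Bijective fun x : Fin (n + 1) × Equiv.Perm (Fin n) => insertAt p x.1 x.2 := by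
  rw [Fintype.bijective_iff_injective_and_card]
  refine ⟨?_, by simp [Fintype.card_perm, Nat.factorial_succ]⟩
  rintro ⟨q, τ⟩ ⟨q', τ'⟩ h
  dsimp only at h
  obtain rfl : q = q' := by simpa using DFunLike.congr_fun h p
  rw [insertAt_left_inj.1 h]

theorem bijective_insertAt_value {n : ℕ} (q : Fin (n + 1)) :
    Function.Bijective fun x : Fin (n + 1) × Equiv.Perm (Fin n) => insertAt x.1 q x.2 := by
  rw [Fintype.bijective_iff_injective_and_card]
  refine ⟨?_, by simp [Fintype.card_perm, Nat.factorial_succ]⟩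
  rintro ⟨p, τ⟩ ⟨p', τ'⟩ h
  dsimp only at h
  obtain rfl : p = p' := (insertAt p' q τ').injective (by simpa [h] using insertAt_self p q τ)
  rw [insertAt_left_inj.1 h]

end Equiv.Perm

theorem alternating_insertAt_zero {n : ℕ} (q : Fin (n + 2)) (τ : Equiv.Perm (Fin (n + 1))) :
    Alternating (Equiv.Perm.insertAt 0 q (τ.trans Fin.revPerm)) ↔
      Alternating τ ∧ n - (τ 0).val < q.val := by
  set σ := Equiv.Perm.insertAt 0 q (τ.trans Fin.revPerm) with hσ
  have h0 : σ 0 = q := by simp [σ]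
  have hs : ∀ k, σ (Fin.succ k) = q.succAbove (Fin.rev (τ k)) := by
    intro k
    rw [hσ, ← Fin.zero_succAbove, Equiv.Perm.insertAt_succAbove]
    simp
  have hlt : ∀ k l, σ (Fin.succ k) < σ (Fin.succ l) ↔ τ l < τ k := by
    intro k l
    rw [hs, hs, Fin.succAbove_lt_succAbove_iff, Fin.rev_lt_rev]
  have h1 : σ (Fin.succ 0) < σ 0 ↔ n - (τ 0).val < q.val := by
    rw [hs, h0, Fin.succAbove_lt_iff_castSucc_lt, Fin.lt_def]
    simp [Fin.val_rev]
  constructor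
  · intro h
    refine ⟨fun i hi => ?_, h1.1 ?_⟩
    · have := h i.succ (by simpa using hi)
      have e : (⟨i.succ.val + 1, by simpa using hi⟩ : Fin (n + 2)) =
        Fin.succ ⟨i.val + 1, hi⟩ := rfl
      rw [e, hlt, hlt] at this
      simp only [Fin.val_succ] at this
      split_ifs at this ⊢ <;> first | assumption | omega
    · simpa using h 0 (by simp)
  · rintro ⟨h, hq⟩ i
    refine Fin.cases ?_ (fun k => ?_) i
    · intro _
      simpa using h1.2 hq
    · intro hk
      have e : (⟨k.succ.val + 1, hk⟩ : Fin (n + 2)) =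
        Fin.succ ⟨k.val + 1, by simpa using hk⟩ := rfl
      have := h k (by simpa using hk)
      rw [e, hlt, hlt]
      simp only [Fin.val_succ]
      split_ifs at this ⊢ <;> first | assumption | omega

/-- The number of alternating permutations of length `n + 1` with first value `i`. -/
noncomputable def entringerCount (n i : ℕ) : ℕ :=
  Nat.card {τ : Equiv.Perm (Fin (n + 1)) // Alternating τ ∧ (τ 0).val = i}

theorem entringerCount_succ_eq_card (n i : ℕ) (hi : i ≤ n + 1) :
    entringerCount (n + 1) i =
      Nat.card {τ : Equiv.Perm (Fin (n + 1)) // Alternating τ ∧ n - (τ 0).val < i} := by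
  symm
  let q : Fin (n + 2) := ⟨i, by omega⟩
  refine Nat.card_congr (Equiv.ofBijective (fun τ =>
    ⟨Equiv.Perm.insertAt 0 q (τ.1.trans Fin.revPerm),
      (alternating_insertAt_zero q τ.1).2 τ.2, by simp [q]⟩) ⟨?_, ?_⟩)
  · intro τ τ' h
    have h := Equiv.Perm.insertAt_left_inj.1 (Subtype.ext_iff.1 h)
    ext k
    have := DFunLike.congr_fun h k
    simpa [Fin.ext_iff] using congrArg Fin.rev this
  · rintro ⟨σ, hσ, h0⟩
    obtain ⟨⟨q', ρ⟩, rfl⟩ := (Equiv.Perm.bijective_insertAt_position 0).2 σ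
    have hq : q' = q := by
      apply Fin.ext
      simpa [q] using h0
    have hρ : (ρ.trans Fin.revPerm).trans Fin.revPerm = ρ := by ext; simp
    subst hq
    dsimp only at hσ h0
    rw [← hρ] at hσ
    exact ⟨⟨ρ.trans Fin.revPerm, (alternating_insertAt_zero _ _).1 hσ⟩, by simp [hρ]⟩

theorem entringerCount_zero_zero : entringerCount 0 0 = 1 := by
  rw [entringerCount, Nat.card_eq_one_iff_unique]
  refine ⟨⟨fun a b => Subtype.ext (Equiv.ext fun k => Fin.ext (by omega))⟩, ⟨⟨1, ?_, rfl⟩⟩⟩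
  intro i h
  omega

theorem entringerCount_succ_zero (n : ℕ) : entringerCount (n + 1) 0 = 0 := by
  rw [entringerCount_succ_eq_card n 0 (by omega)]
  simp

theorem entringerCount_succ_succ (n i : ℕ) (hi : i ≤ n) :
    entringerCount (n + 1) (i + 1) = entringerCount (n + 1) i + entringerCount n (n - i) := by
  classical
  rw [entringerCount_succ_eq_card n _ (by omega), entringerCount_succ_eq_card n _ (by omega),
    entringerCount]
  simp only [Nat.card_eq_fintype_card, Fintype.card_subtype]
  rw [← Finset.card_union_of_disjoint]
  · congr 1
    ext τ
    have := (τ 0).isLt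
    simp only [Finset.mem_filter, Finset.mem_univ, true_and, Finset.mem_union, ← and_or_left]
    refine and_congr_right fun _ => ?_
    omega
  · rw [Finset.disjoint_filter]
    rintro τ _ ⟨_, h⟩ ⟨_, h'⟩
    have := (τ 0).isLt
    omega

theorem card_alternating_eq_entringerCount (n : ℕ) :
    Nat.card {τ : Equiv.Perm (Fin (n + 1)) // Alternating τ} =
      entringerCount (n + 1) (n + 1) := by
  rw [entringerCount_succ_eq_card n _ le_rfl]
  refine Nat.card_congr (Equiv.subtypeEquivRight fun τ => ?_)
  simp only [iff_self_and]
  omega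

/-- The exponential generating function of the Euler numbers. -/
noncomputable def eulerGenFun : PowerSeries ℚ :=
  expGenFun fun n => entringerCount n n

open PowerSeries in
theorem two_mul_derivative_eulerGenFun : 2 * d⁄dX ℚ eulerGenFun = 1 + eulerGenFun ^ 2 := by
  refine two_mul_derivative_expGenFun_boundary (fun i j => (entringerCount (i + j) i : ℚ))
    ?_ ?_ ?_
  · simp [entringerCount_zero_zero]
  · intro j
    simp [← add_assoc, entringerCount_succ_zero]
  · intro i j
    have := entringerCount_succ_succ (i + j) i (by omega)
    rw [Nat.add_sub_cancel_left] at this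
    rw [show i + 1 + j = i + j + 1 by ring, show i + (j + 1) = i + j + 1 by ring, add_comm j i]
    exact_mod_cast this

open PowerSeries in
theorem derivative_derivative_eulerGenFun :
    d⁄dX ℚ (d⁄dX ℚ eulerGenFun) = d⁄dX ℚ eulerGenFun * eulerGenFun := by
  have h := congrArg (d⁄dX ℚ) two_mul_derivative_eulerGenFun
  have h2 : d⁄dX ℚ (2 : ℚ⟦X⟧) = 0 := by
    simpa using (d⁄dX ℚ).map_natCast 2
  simp only [map_add, Derivation.leibniz, smul_eq_mul, PowerSeries.derivative_pow, h2,
    derivative_one] at h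
  have h0 : (2 : ℚ⟦X⟧) ≠ 0 := fun h => by
    simpa [map_ofNat] using congrArg constantCoeff h
  apply mul_left_cancel₀ h0
  linear_combination h

open PowerSeries in
theorem constantCoeff_iterate_derivative_eulerGenFun (n : ℕ) :
    constantCoeff ((d⁄dX ℚ)^[n] (d⁄dX ℚ eulerGenFun)) =
      Nat.card {τ : Equiv.Perm (Fin (n + 1)) // Alternating τ} := by
  rw [← Function.iterate_succ_apply, eulerGenFun, constantCoeff_iterate_derivative_expGenFun,
    card_alternating_eq_entringerCount]

theorem constantCoeff_eulerGenFun : PowerSeries.constantCoeff eulerGenFun = 1 := by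
  simp [eulerGenFun, expGenFun, entringerCount_zero_zero]

open PowerSeries in
theorem constantCoeff_derivative_eulerGenFun :
    constantCoeff (d⁄dX ℚ eulerGenFun) = 1 := by
  have := congrArg constantCoeff two_mul_derivative_eulerGenFun
  rw [map_mul, map_ofNat] at this
  simp [constantCoeff_eulerGenFun] at this
  linarith

/-- The positions `i` with `τ (i + 1) < τ i`. -/
def descSet {n : ℕ} (τ : Equiv.Perm (Fin n)) : Finset ℕ :=
  (Finset.range n).filter fun i => ∃ (h : i < n) (h' : i + 1 < n), τ ⟨i + 1, h'⟩ < τ ⟨i, h⟩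

theorem mem_descSet {n : ℕ} {τ : Equiv.Perm (Fin n)} {i : ℕ} :
    i ∈ descSet τ ↔ ∃ (h : i < n) (h' : i + 1 < n), τ ⟨i + 1, h'⟩ < τ ⟨i, h⟩ := by
  simp only [descSet, Finset.mem_filter, Finset.mem_range, and_iff_right_iff_imp]
  exact fun h => h.1

theorem lt_of_mem_descSet {n : ℕ} {τ : Equiv.Perm (Fin n)} {i : ℕ} (h : i ∈ descSet τ) :
    i + 1 < n := by
  obtain ⟨_, h, _⟩ := mem_descSet.1 h
  exact h

theorem Simsun.succ_notMem_descSet {n : ℕ} {τ : Equiv.Perm (Fin n)} (hτ : Simsun τ) {i : ℕ}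
    (hi : i ∈ descSet τ) : i + 1 ∉ descSet τ := by
  intro hi'
  obtain ⟨h1, h2, h⟩ := mem_descSet.1 hi
  obtain ⟨_, h3, h'⟩ := mem_descSet.1 hi'
  refine hτ n ⟨⟨i, h1⟩, ⟨i + 1, h2⟩, ⟨i + 1 + 1, h3⟩, ?_, ?_, (τ _).isLt, (τ _).isLt, (τ _).isLt,
    h', h, ?_, ?_⟩
  · simp [Fin.lt_def]
  · simp [Fin.lt_def]
  all_goals
    intro m hm hm'
    simp only [Fin.lt_def] at hm hm'
    omega

theorem Fin.val_succAbove_eq_ite {n : ℕ} (p : Fin (n + 1)) (k : Fin n) :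
    (p.succAbove k).val = if k.val < p.val then k.val else k.val + 1 := by
  simp only [Fin.succAbove, Fin.lt_def, Fin.val_castSucc]
  split_ifs <;> rfl

theorem simsun_insertAt_last {n : ℕ} (p : Fin (n + 1)) (τ : Equiv.Perm (Fin n)) :
    Simsun (Equiv.Perm.insertAt p (Fin.last n) τ) ↔ Simsun τ ∧ p.val ∉ descSet τ := by
  set σ := Equiv.Perm.insertAt p (Fin.last n) τ with hσ
  have hp : σ p = Fin.last n := by simp [σ]
  have hs : ∀ k, σ (p.succAbove k) = (τ k).castSucc := by simp [σ]
  constructor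
  · refine fun h => ⟨?_, ?_⟩
    · rintro k ⟨i, j, l, hij, hjl, hi, hj, hl, hlj, hji, hm, hm'⟩
      refine h (min k n) ⟨p.succAbove i, p.succAbove j, p.succAbove l, ?_, ?_, ?_, ?_, ?_, ?_, ?_,
        ?_, ?_⟩
      · simpa
      · simpa
      · simpa [hs] using hi
      · simpa [hs] using hj
      · simpa [hs] using hl
      · simpa [hs] using hlj
      · simpa [hs] using hji
      all_goals
        intro m h1 h2
        by_cases e : m = p
        · simp [e, hp]
        · obtain ⟨m, rfl⟩ := Fin.exists_succAbove_eq e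
          rw [Fin.succAbove_lt_succAbove_iff] at h1 h2
          rw [hs]
          simp only [Fin.val_castSucc, inf_le_iff]
          left
          first | exact hm m h1 h2 | exact hm' m h1 h2
    · intro hd
      obtain ⟨h1, h2, hlt⟩ := mem_descSet.1 hd
      have e1 : p.succAbove ⟨p.val, h1⟩ = ⟨p.val + 1, by omega⟩ := by
        apply Fin.ext
        simp [Fin.val_succAbove_eq_ite]
      have e2 : p.succAbove ⟨p.val + 1, h2⟩ = ⟨p.val + 2, by omega⟩ := by
        apply Fin.ext
        simp [Fin.val_succAbove_eq_ite]
      refine h (n + 1) ⟨p, p.succAbove ⟨p.val, h1⟩, p.succAbove ⟨p.val + 1, h2⟩, ?_, ?_,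
        (σ _).isLt, (σ _).isLt, (σ _).isLt, ?_, ?_, ?_, ?_⟩
      · simp [e1, Fin.lt_def]
      · rw [e1, e2, Fin.lt_def]
        simp
      · simpa [hs] using hlt
      · rw [hs, hp]
        exact Fin.castSucc_lt_last _
      all_goals
        intro m hm hm'
        simp only [e1, e2, Fin.lt_def] at hm hm'
        omega
  · rintro ⟨h, hd⟩ k ⟨i, j, l, hij, hjl, hi, hj, hl, hlj, hji, hm, hm'⟩
    have hjp : j ≠ p := by
      rintro rfl
      rw [hp] at hji
      exact absurd hji (Fin.le_last _).not_gt
    have hlp : l ≠ p := by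
      rintro rfl
      rw [hp] at hlj
      exact absurd hlj (Fin.le_last _).not_gt
    by_cases hip : i = p
    · subst hip
      have hk : n + 1 ≤ k := by simpa [hp] using hi
      have e1 : j.val = i.val + 1 := by
        by_contra hne
        have := hm ⟨i.val + 1, by omega⟩ (by simp [Fin.lt_def])
          (by simp only [Fin.lt_def] at *; omega)
        omega
      have e2 : l.val = i.val + 2 := by
        by_contra hne
        have := hm' ⟨i.val + 2, by omega⟩ (by simp [Fin.lt_def, e1])
          (by simp only [Fin.lt_def] at *; omega)
        omega
      obtain ⟨j, rfl⟩ := Fin.exists_succAbove_eq hjp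
      obtain ⟨l, rfl⟩ := Fin.exists_succAbove_eq hlp
      simp only [hs, Fin.castSucc_lt_castSucc_iff] at hlj
      have f1 : j.val = i.val := by
        rw [Fin.val_succAbove_eq_ite] at e1
        split_ifs at e1 <;> omega
      have f2 : l.val = i.val + 1 := by
        rw [Fin.val_succAbove_eq_ite] at e2
        split_ifs at e2 <;> omega
      apply hd
      rw [mem_descSet, ← f1]
      refine ⟨j.isLt, by omega, ?_⟩
      have e : (⟨j.val + 1, by omega⟩ : Fin n) = l := Fin.ext (by simp only; omega)
      rwa [e]
    · obtain ⟨i, rfl⟩ := Fin.exists_succAbove_eq hip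
      obtain ⟨j, rfl⟩ := Fin.exists_succAbove_eq hjp
      obtain ⟨l, rfl⟩ := Fin.exists_succAbove_eq hlp
      simp only [hs, Fin.val_castSucc, Fin.castSucc_lt_castSucc_iff,
        Fin.succAbove_lt_succAbove_iff] at hij hjl hi hj hl hlj hji
      refine h k ⟨i, j, l, hij, hjl, hi, hj, hl, hlj, hji, fun m h1 h2 => ?_, fun m h1 h2 => ?_⟩
      · simpa [hs] using hm (p.succAbove m) (by simpa) (by simpa)
      · simpa [hs] using hm' (p.succAbove m) (by simpa) (by simpa)

theorem mem_descSet_insertAt_last {n : ℕ} (p : Fin (n + 1)) (τ : Equiv.Perm (Fin n)) (i : ℕ) :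
    i ∈ descSet (Equiv.Perm.insertAt p (Fin.last n) τ) ↔
      (i + 1 < p.val ∧ i ∈ descSet τ) ∨ (i = p.val ∧ p.val < n) ∨
        (p.val < i ∧ i - 1 ∈ descSet τ) := by
  set σ := Equiv.Perm.insertAt p (Fin.last n) τ with hσ
  have hp : ∀ h, σ ⟨p.val, h⟩ = Fin.last n := by simp [σ]
  have hlow : ∀ (j : ℕ) (hj : j < p.val), σ ⟨j, by omega⟩ = (τ ⟨j, by omega⟩).castSucc := by
    intro j hj
    have e : (⟨j, by omega⟩ : Fin (n + 1)) = p.succAbove ⟨j, by omega⟩ := by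
      apply Fin.ext
      simp [Fin.val_succAbove_eq_ite, hj]
    rw [e, hσ, Equiv.Perm.insertAt_succAbove, Fin.succAbove_last]
  have hhigh : ∀ (j : ℕ) (hj : p.val ≤ j) (h : j < n),
      σ ⟨j + 1, by omega⟩ = (τ ⟨j, h⟩).castSucc := by
    intro j hj h
    have e : (⟨j + 1, by omega⟩ : Fin (n + 1)) = p.succAbove ⟨j, by omega⟩ := by
      apply Fin.ext
      simp [Fin.val_succAbove_eq_ite, hj.not_gt]
    rw [e, hσ, Equiv.Perm.insertAt_succAbove, Fin.succAbove_last]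
  have hpn := p.isLt
  rw [mem_descSet]
  rcases lt_trichotomy i p.val with hi | rfl | hi
  · by_cases hi' : i + 1 < p.val
    · simp only [hi', hi.ne, hi.not_gt, true_and, false_and, or_false, mem_descSet, hlow i hi,
        hlow _ hi', Fin.castSucc_lt_castSucc_iff]
      constructor
      · rintro ⟨_, _, h⟩
        exact ⟨by omega, by omega, h⟩
      · rintro ⟨_, _, h⟩
        exact ⟨by omega, by omega, h⟩
    · have e : i + 1 = p.val := by omega
      simp only [hi', hi.ne, hi.not_gt, false_and, or_false, iff_false]
      rintro ⟨_, _, h⟩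
      simp only [e, hp] at h
      exact absurd h (Fin.le_last _).not_gt
  · simp only [lt_irrefl, false_and, or_false, true_and, Nat.not_lt_of_le (Nat.le_succ _),
      false_or]
    constructor
    · rintro ⟨_, h, _⟩
      omega
    · intro h
      refine ⟨by omega, by omega, ?_⟩
      rw [hp, hhigh _ le_rfl h]
      exact Fin.castSucc_lt_last _
  · obtain ⟨j, rfl⟩ : ∃ j, i = j + 1 := ⟨i - 1, by omega⟩
    have e1 : ¬ (j + 1 + 1 < p.val) := by omega
    simp only [e1, hi.ne', hi, true_and, false_and, false_or, mem_descSet, Nat.add_sub_cancel]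
    constructor
    · rintro ⟨_, _, h⟩
      refine ⟨by omega, by omega, ?_⟩
      rwa [hhigh j (by omega) (by omega), hhigh (j + 1) (by omega) (by omega),
        Fin.castSucc_lt_castSucc_iff] at h
    · rintro ⟨_, _, h⟩
      refine ⟨by omega, by omega, ?_⟩
      rwa [hhigh j (by omega) (by omega), hhigh (j + 1) (by omega) (by omega),
        Fin.castSucc_lt_castSucc_iff]

theorem card_descSet_insertAt_last {n : ℕ} (p : Fin (n + 1)) (τ : Equiv.Perm (Fin n)) :
    (descSet (Equiv.Perm.insertAt p (Fin.last n) τ)).card =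
      if p.val = n ∨ p.val ∈ (descSet τ).image Nat.succ then (descSet τ).card
      else (descSet τ).card + 1 := by
  set s := descSet τ with hs
  have hpn := p.isLt
  let φ : ℕ → ℕ := fun i => if i < p.val then i else i + 1
  have hφ : Function.Injective φ := by
    intro i j h
    simp only [φ] at h
    split_ifs at h <;> omega
  have hunion : descSet (Equiv.Perm.insertAt p (Fin.last n) τ) =
      (s.filter fun i => i + 1 ≠ p.val).image φ ∪ (if p.val < n then {p.val} else ∅) := by
    ext i
    rw [mem_descSet_insertAt_last]
    have hr : i ∈ (if p.val < n then ({p.val} : Finset ℕ) else ∅) ↔ i = p.val ∧ p.val < n := by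
      split_ifs with h <;> simp [h]
    simp only [Finset.mem_union, hr, Finset.mem_image, Finset.mem_filter, φ]
    constructor
    · rintro (⟨h, h'⟩ | h | ⟨h, h'⟩)
      · exact .inl ⟨i, ⟨h', by omega⟩, if_pos (by omega)⟩
      · exact .inr h
      · exact .inl ⟨i - 1, ⟨h', by omega⟩, by rw [if_neg (by omega)]; omega⟩
    · rintro (⟨j, ⟨hj, hj'⟩, h⟩ | h)
      · split_ifs at h with hlt
        · subst h
          exact .inl ⟨by omega, hj⟩
        · subst h
          exact .inr (.inr ⟨by omega, hj⟩)
      · exact .inr (.inl h)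
  have hdisj : Disjoint ((s.filter fun i => i + 1 ≠ p.val).image φ)
      (if p.val < n then {p.val} else ∅) := by
    split_ifs
    · rw [Finset.disjoint_singleton_right, Finset.mem_image]
      rintro ⟨j, -, h⟩
      simp only [φ] at h
      split_ifs at h <;> omega
    · simp
  have hfilter : (s.filter fun i => i + 1 ≠ p.val).card =
      if p.val ∈ s.image Nat.succ then s.card - 1 else s.card := by
    split_ifs with h
    · obtain ⟨j, hj, hjp⟩ := Finset.mem_image.1 h
      have : (s.filter fun i => i + 1 ≠ p.val) = s.erase j := by
        ext i
        rw [Finset.mem_filter, Finset.mem_erase]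
        constructor
        · rintro ⟨h1, h2⟩
          exact ⟨by omega, h1⟩
        · rintro ⟨h1, h2⟩
          exact ⟨h2, by omega⟩
      rw [this, Finset.card_erase_of_mem hj]
    · rw [Finset.filter_true_of_mem]
      intro i hi e
      exact h (Finset.mem_image.2 ⟨i, hi, e⟩)
  rw [hunion, Finset.card_union_of_disjoint hdisj, Finset.card_image_of_injective _ hφ, hfilter]
  by_cases h : p.val ∈ s.image Nat.succ
  · obtain ⟨j, hj, hjp⟩ := Finset.mem_image.1 h
    have hjn := lt_of_mem_descSet hj
    have hpos : 0 < s.card := Finset.card_pos.2 ⟨j, hj⟩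
    have hlt : p.val < n := by omega
    simp only [h, hlt, if_true, or_true, Finset.card_singleton]
    omega
  · by_cases hlt : p.val < n
    · simp [h, hlt, hlt.ne]
    · have hpn' : p.val = n := by omega
      rw [if_neg h, if_neg hlt, if_pos (.inl hpn'), Finset.card_empty, add_zero]

theorem Simsun.disjoint_descSet {n : ℕ} {τ : Equiv.Perm (Fin n)} (hτ : Simsun τ) :
    Disjoint (descSet τ) ((descSet τ).image Nat.succ) := by
  rw [Finset.disjoint_right]
  intro i hi
  obtain ⟨j, hj, rfl⟩ := Finset.mem_image.1 hi
  exact hτ.succ_notMem_descSet hj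

theorem descSet_union_image_succ_subset {n : ℕ} (τ : Equiv.Perm (Fin n)) :
    descSet τ ∪ (descSet τ).image Nat.succ ⊆ Finset.range n := by
  intro i hi
  rw [Finset.mem_range]
  rcases Finset.mem_union.1 hi with hi | hi
  · have := lt_of_mem_descSet hi
    omega
  · obtain ⟨j, hj, rfl⟩ := Finset.mem_image.1 hi
    exact lt_of_mem_descSet hj

theorem Simsun.card_union {n : ℕ} {τ : Equiv.Perm (Fin n)} (hτ : Simsun τ) :
    (descSet τ ∪ (descSet τ).image Nat.succ).card = 2 * (descSet τ).card := by
  rw [Finset.card_union_of_disjoint hτ.disjoint_descSet,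
    Finset.card_image_of_injective _ Nat.succ_injective, two_mul]

theorem Simsun.two_mul_card_descSet_le {n : ℕ} {τ : Equiv.Perm (Fin n)} (hτ : Simsun τ) :
    2 * (descSet τ).card ≤ n := by
  simpa [hτ.card_union] using Finset.card_le_card (descSet_union_image_succ_subset τ)

open scoped Classical in
theorem Simsun.sum_insertAt_last {n : ℕ} {τ : Equiv.Perm (Fin n)} (hτ : Simsun τ) (f : ℕ → ℚ) :
    (∑ p : Fin (n + 1), if p.val ∈ descSet τ then 0 else
      f (descSet (Equiv.Perm.insertAt p (Fin.last n) τ)).card) =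
        ((descSet τ).card + 1 : ℕ) * f (descSet τ).card +
          (n - 2 * (descSet τ).card : ℕ) * f ((descSet τ).card + 1) := by
  simp only [card_descSet_insertAt_last]
  set s := descSet τ with hs
  have hn : n ∉ s := fun h => by
    have := lt_of_mem_descSet h
    omega
  rw [Fin.sum_univ_eq_sum_range (fun p => if p ∈ s then 0 else
    f (if p = n ∨ p ∈ s.image Nat.succ then s.card else s.card + 1)), Finset.sum_range_succ,
    ← Finset.sum_sdiff (descSet_union_image_succ_subset τ), Finset.sum_union hτ.disjoint_descSet]
  have h1 : ∀ p ∈ Finset.range n \ (s ∪ s.image Nat.succ), (if p ∈ s then 0 else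
      f (if p = n ∨ p ∈ s.image Nat.succ then s.card else s.card + 1)) = f (s.card + 1) := by
    intro p hp
    rw [Finset.mem_sdiff, Finset.mem_union, not_or, Finset.mem_range] at hp
    rw [if_neg hp.2.1, if_neg]
    exact not_or.2 ⟨hp.1.ne, hp.2.2⟩
  have h2 : ∀ p ∈ s, (if p ∈ s then 0 else
      f (if p = n ∨ p ∈ s.image Nat.succ then s.card else s.card + 1)) = 0 :=
    fun p hp => if_pos hp
  have h3 : ∀ p ∈ s.image Nat.succ, (if p ∈ s then 0 else
      f (if p = n ∨ p ∈ s.image Nat.succ then s.card else s.card + 1)) = f s.card := by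
    intro p hp
    rw [if_neg (Finset.disjoint_right.1 hτ.disjoint_descSet hp), if_pos (.inr hp)]
  rw [Finset.sum_congr rfl h1, Finset.sum_congr rfl h2, Finset.sum_congr rfl h3, if_neg hn,
    if_pos (.inl rfl), Finset.sum_const, Finset.sum_const, Finset.sum_const, smul_zero,
    Finset.card_sdiff_of_subset (descSet_union_image_succ_subset τ), hτ.card_union,
    Finset.card_image_of_injective _ Nat.succ_injective, Finset.card_range]
  simp only [nsmul_eq_mul]
  push_cast
  ring

open scoped Classical in
theorem sum_simsun_succ (n : ℕ) (f : ℕ → ℚ) :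
    (∑ σ : Equiv.Perm (Fin (n + 1)) with Simsun σ, f (descSet σ).card) =
      ∑ τ : Equiv.Perm (Fin n) with Simsun τ, (((descSet τ).card + 1 : ℕ) * f (descSet τ).card +
        (n - 2 * (descSet τ).card : ℕ) * f ((descSet τ).card + 1)) := by
  rw [Finset.sum_filter, ← (Equiv.Perm.bijective_insertAt_value (Fin.last n)).sum_comp,
    Fintype.sum_prod_type_right, Finset.sum_filter]
  refine Finset.sum_congr rfl fun τ _ => ?_
  simp only [simsun_insertAt_last]
  split_ifs with hτ
  · rw [← hτ.sum_insertAt_last]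
    exact Finset.sum_congr rfl fun p _ => by by_cases h : p.val ∈ descSet τ <;> simp [h, hτ]
  · simp [hτ]

open PowerSeries in
open scoped Classical in
theorem sum_simsun_constantCoeff (n m : ℕ) :
    (∑ σ : Equiv.Perm (Fin n) with Simsun σ, constantCoeff ((d⁄dX ℚ)^[m]
      ((d⁄dX ℚ eulerGenFun) ^ ((descSet σ).card + 1) *
        eulerGenFun ^ (n - 2 * (descSet σ).card)))) =
      Nat.card {τ : Equiv.Perm (Fin (n + m + 1)) // Alternating τ} := by
  induction n generalizing m with
  | zero =>
    have hs : ∀ σ : Equiv.Perm (Fin 0), Simsun σ := fun σ k ⟨i, _⟩ => i.elim0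
    have hd : ∀ σ : Equiv.Perm (Fin 0), descSet σ = ∅ := fun σ => by simp [descSet]
    rw [zero_add, ← constantCoeff_iterate_derivative_eulerGenFun]
    simp [hs, hd]
  | succ n ih =>
    rw [sum_simsun_succ n fun d => constantCoeff ((d⁄dX ℚ)^[m]
      ((d⁄dX ℚ eulerGenFun) ^ (d + 1) * eulerGenFun ^ (n + 1 - 2 * d))),
      show n + 1 + m + 1 = n + (m + 1) + 1 by ring, ← ih]
    refine Finset.sum_congr rfl fun τ hτ => ?_
    have := (Finset.mem_filter.1 hτ).2.two_mul_card_descSet_le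
    rw [constantCoeff_iterate_derivative_monomial rfl derivative_derivative_eulerGenFun]
    congr 6
    · omega
    · omega

/-- The number of simsun permutations in `S_n` equals the Euler number
`E_{n+1}`, i.e. the number of alternating permutations of length `n+1`. -/
theorem simsun_card_eq_euler (n : ℕ) :
    Nat.card {σ : Equiv.Perm (Fin n) // Simsun σ} =
      Nat.card {τ : Equiv.Perm (Fin (n + 1)) // Alternating τ} := by
  classical
  have h := sum_simsun_constantCoeff n 0
  simp only [Function.iterate_zero, id, map_mul, map_pow, constantCoeff_eulerGenFun,
    constantCoeff_derivative_eulerGenFun, one_pow, mul_one, Finset.sum_const, nsmul_eq_mul] at h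
  rw [Nat.card_eq_fintype_card, Fintype.card_subtype]
  exact_mod_cast h
end

section
/- The number of 213-avoiding simsun permutations in S_n equals the n-th Motzkin number M_n. -/
section BinomialTransform

/-- The binomial transform `h ↦ ∑ j, (h choose j) * a j`, defined by Pascal's rule. -/
def binomialTransform : ℕ → (ℕ → ℕ) → ℕ
  | 0, a => a 0
  | h + 1, a => binomialTransform h a + binomialTransform h fun j => a (j + 1)

/-- The right shift of a sequence, extended by zero. -/
def shiftRight (a : ℕ → ℕ) : ℕ → ℕ
  | 0 => 0
  | h + 1 => a h

/-- The transfer operator of the generating tree in which a node labelled `h` has children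
labelled `0, …, h - 1` and `h + 1`. -/
def treeTransfer (φ : ℕ → ℕ) (h : ℕ) : ℕ := φ (h + 1) + ∑ j ∈ Finset.range h, φ j

/-- The number of Motzkin paths with `n` steps from height `h` to height `0`. -/
def motzkinCount : ℕ → ℕ → ℕ
  | 0, h => if h = 0 then 1 else 0
  | n + 1, h => motzkinCount n (h + 1) + motzkinCount n h + shiftRight (motzkinCount n) h

theorem binomialTransform_add (h : ℕ) (a b : ℕ → ℕ) :
    binomialTransform h (fun j => a j + b j) = binomialTransform h a + binomialTransform h b := by
  induction h generalizing a b with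
  | zero => rfl
  | succ h ih => simp only [binomialTransform, ih]; ring

theorem binomialTransform_shiftRight (h : ℕ) (a : ℕ → ℕ) :
    binomialTransform h (shiftRight a) = ∑ j ∈ Finset.range h, binomialTransform j a := by
  induction h with
  | zero => rfl
  | succ h ih => rw [Finset.sum_range_succ, ← ih]; rfl

theorem binomialTransform_zero_seq (h : ℕ) : binomialTransform h (fun _ => 0) = 0 := by
  induction h with
  | zero => rfl
  | succ h ih => simp [binomialTransform, ih]

theorem binomialTransform_motzkinCount_zero (h : ℕ) :
    binomialTransform h (motzkinCount 0) = 1 := by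
  induction h with
  | zero => rfl
  | succ h ih =>
    have : (fun j => motzkinCount 0 (j + 1)) = fun _ => 0 := by
      funext j
      simp [motzkinCount]
    rw [binomialTransform, ih, this, binomialTransform_zero_seq]

theorem iterate_treeTransfer_one (n : ℕ) :
    treeTransfer^[n] (fun _ => 1) = fun h => binomialTransform h (motzkinCount n) := by
  induction n with
  | zero => funext h; simp [binomialTransform_motzkinCount_zero]
  | succ n ih =>
    rw [Function.iterate_succ_apply', ih]
    funext h
    have : motzkinCount (n + 1) = fun j =>
        (motzkinCount n (j + 1) + motzkinCount n j) + shiftRight (motzkinCount n) j := rfl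
    rw [this, binomialTransform_add, binomialTransform_add, binomialTransform_shiftRight,
      treeTransfer, binomialTransform]
    ring

end BinomialTransform

section MotzkinPaths

/-- `p` is a path with Motzkin steps from height `h` to height `0` staying nonnegative. -/
def MotzkinPathFrom (h : ℕ) (p : List ℤ) : Prop :=
  (∀ s ∈ p, s = 1 ∨ s = -1 ∨ s = 0) ∧ (∀ t : List ℤ, t <+: p → 0 ≤ h + t.sum) ∧ h + p.sum = 0

theorem motzkinPathFrom_cons (h : ℕ) (s : ℤ) (p : List ℤ) :
    MotzkinPathFrom h (s :: p) ↔ (s = 1 ∨ s = -1 ∨ s = 0) ∧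
      ∃ h' : ℕ, (h' : ℤ) = h + s ∧ MotzkinPathFrom h' p := by
  constructor
  · rintro ⟨h1, h2, h3⟩
    refine ⟨h1 s (by simp), (h + s).toNat, ?_, fun x hx => h1 x (by simp [hx]), ?_, ?_⟩
    · have := h2 [s] (by simp)
      simp at this
      omega
    · intro t ht
      have := h2 (s :: t) (by simpa using ht)
      have := h2 [s] (by simp)
      simp at *
      omega
    · have := h2 [s] (by simp)
      simp at *
      omega
  · rintro ⟨hs, h', hh', h1, h2, h3⟩
    refine ⟨by simpa using ⟨hs, h1⟩, ?_, ?_⟩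
    · intro t ht
      rcases List.prefix_cons_iff.1 ht with rfl | ⟨t, rfl, ht'⟩
      · simp
      · have := h2 t ht'
        simp
        omega
    · simp
      omega

/-- The Motzkin paths with `n` steps from height `h` to height `0`. -/
def motzkinPaths : ℕ → ℕ → Finset (List ℤ)
  | 0, h => if h = 0 then {[]} else ∅
  | n + 1, h =>
    (motzkinPaths n (h + 1)).image (List.cons 1) ∪ (motzkinPaths n h).image (List.cons 0) ∪
      match h with
      | 0 => ∅
      | h + 1 => (motzkinPaths n h).image (List.cons (-1))

theorem mem_motzkinPaths (n h : ℕ) (p : List ℤ) :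
    p ∈ motzkinPaths n h ↔ p.length = n ∧ MotzkinPathFrom h p := by
  induction n generalizing h p with
  | zero =>
    rw [List.length_eq_zero_iff]
    by_cases hh : h = 0
    · simp only [motzkinPaths, hh, if_true, Finset.mem_singleton]
      constructor
      · rintro rfl
        simp [MotzkinPathFrom]
      · exact fun h => h.1
    · simp only [motzkinPaths, hh, if_false, Finset.notMem_empty, false_iff]
      rintro ⟨rfl, -, -, h3⟩
      simp at h3
      omega
  | succ n ih =>
    cases p with
    | nil => cases h <;> simp [motzkinPaths]
    | cons s p =>
      rw [motzkinPathFrom_cons]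
      cases h with
      | zero =>
        simp only [motzkinPaths, Finset.mem_union, Finset.mem_image, List.cons.injEq, ih,
          List.length_cons, add_left_inj, Finset.notMem_empty, or_false]
        constructor
        · rintro (⟨a, ⟨h1, h2⟩, rfl, rfl⟩ | ⟨a, ⟨h1, h2⟩, rfl, rfl⟩)
          · exact ⟨h1, by simp, _, by simp, h2⟩
          · exact ⟨h1, by simp, _, by simp, h2⟩
        · rintro ⟨hl, rfl | rfl | rfl, h', hh', hp⟩
          · obtain rfl : h' = 0 + 1 := by omega
            exact Or.inl ⟨p, ⟨hl, hp⟩, rfl, rfl⟩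
          · omega
          · obtain rfl : h' = 0 := by omega
            exact Or.inr ⟨p, ⟨hl, hp⟩, rfl, rfl⟩
      | succ h =>
        simp only [motzkinPaths, Finset.mem_union, Finset.mem_image, List.cons.injEq, ih,
          List.length_cons, add_left_inj]
        constructor
        · rintro ((⟨a, ⟨h1, h2⟩, rfl, rfl⟩ | ⟨a, ⟨h1, h2⟩, rfl, rfl⟩) | ⟨a, ⟨h1, h2⟩, rfl, rfl⟩)
          · exact ⟨h1, by simp, _, by simp, h2⟩
          · exact ⟨h1, by simp, _, by simp, h2⟩
          · exact ⟨h1, by simp, _, by simp, h2⟩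
        · rintro ⟨hl, rfl | rfl | rfl, h', hh', hp⟩
          · obtain rfl : h' = h + 1 + 1 := by omega
            exact Or.inl (Or.inl ⟨p, ⟨hl, hp⟩, rfl, rfl⟩)
          · obtain rfl : h' = h := by omega
            exact Or.inr ⟨p, ⟨hl, hp⟩, rfl, rfl⟩
          · obtain rfl : h' = h + 1 := by omega
            exact Or.inl (Or.inr ⟨p, ⟨hl, hp⟩, rfl, rfl⟩)

theorem card_motzkinPaths (n h : ℕ) : (motzkinPaths n h).card = motzkinCount n h := by
  induction n generalizing h with
  | zero => by_cases hh : h = 0 <;> simp [motzkinPaths, motzkinCount, hh]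
  | succ n ih =>
    cases h with
    | zero =>
      rw [motzkinPaths, motzkinCount, Finset.union_empty, Finset.card_union_of_disjoint,
        Finset.card_image_of_injective _ List.cons_injective,
        Finset.card_image_of_injective _ List.cons_injective, ih, ih]
      · rfl
      · rw [Finset.disjoint_left]
        simp
    | succ h =>
      rw [motzkinPaths, motzkinCount, Finset.card_union_of_disjoint,
        Finset.card_union_of_disjoint,
        Finset.card_image_of_injective _ List.cons_injective,
        Finset.card_image_of_injective _ List.cons_injective,
        Finset.card_image_of_injective _ List.cons_injective, ih, ih, ih]
      · rfl
      · rw [Finset.disjoint_left]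
        simp
      · rw [Finset.disjoint_left]
        simp only [Finset.mem_union, Finset.mem_image]
        rintro _ (⟨a, -, rfl⟩ | ⟨a, -, rfl⟩) <;> simp

theorem card_motzkinPath (n : ℕ) :
    Nat.card {p : List ℤ // p.length = n ∧ MotzkinPath p} = motzkinCount n 0 := by
  rw [← card_motzkinPaths, ← Nat.card_eq_finsetCard]
  refine Nat.card_congr (Equiv.subtypeEquivRight fun p => ?_)
  simp [mem_motzkinPaths, MotzkinPathFrom, MotzkinPath]

end MotzkinPaths

section Insertion

variable {n : ℕ}

/-- Inserting a new maximal value at position `p` into a permutation. -/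
def insertMax (p : Fin (n + 1)) (σ : Equiv.Perm (Fin n)) : Equiv.Perm (Fin (n + 1)) :=
  (finSuccEquiv' p).trans (σ.optionCongr.trans (finSuccEquiv' (Fin.last n)).symm)

@[simp]
theorem insertMax_self (p : Fin (n + 1)) (σ : Equiv.Perm (Fin n)) :
    insertMax p σ p = Fin.last n := by
  simp [insertMax]

@[simp]
theorem insertMax_succAbove (p : Fin (n + 1)) (σ : Equiv.Perm (Fin n)) (i : Fin n) :
    insertMax p σ (p.succAbove i) = (σ i).castSucc := by
  simp [insertMax]

theorem insertMax_bijective :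
    Function.Bijective fun x : Fin (n + 1) × Equiv.Perm (Fin n) => insertMax x.1 x.2 := by
  rw [Fintype.bijective_iff_injective_and_card]
  constructor
  · rintro ⟨p, σ⟩ ⟨q, τ⟩ h
    have h : insertMax p σ = insertMax q τ := h
    obtain rfl : p = q := by
      apply (insertMax p σ).injective
      rw [insertMax_self, h, insertMax_self]
    congr 1
    ext i
    have := congrArg Fin.val (congrArg (fun f => f (p.succAbove i)) h)
    simpa using this
  · simp [Fintype.card_perm, Nat.factorial_succ]

theorem avoids213_insertMax (p : Fin (n + 1)) (σ : Equiv.Perm (Fin n)) :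
    Avoids213 (insertMax p σ) ↔
      Avoids213 σ ∧ ∀ i j : Fin n, i < j → j.val < p.val → σ i < σ j := by
  constructor
  · intro h
    constructor
    · rintro ⟨i, j, k, hij, hjk, h1, h2⟩
      exact h ⟨p.succAbove i, p.succAbove j, p.succAbove k, by simpa, by simpa, by simpa, by simpa⟩
    · intro i j hij hj
      by_contra hlt
      have hne : σ j ≠ σ i := fun h => hij.ne' (σ.injective h)
      refine h ⟨p.succAbove i, p.succAbove j, p, by simpa, ?_, ?_, ?_⟩
      · rw [Fin.succAbove_of_castSucc_lt _ _ (by simpa [Fin.lt_def] using hj)]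
        simpa [Fin.lt_def] using hj
      · simpa using lt_of_le_of_ne (not_lt.1 hlt) hne
      · simp [Fin.castSucc_lt_last]
  · rintro ⟨h, hp⟩ ⟨i, j, k, hij, hjk, h1, h2⟩
    rcases Fin.eq_self_or_eq_succAbove p i with rfl | ⟨i, rfl⟩
    · rw [insertMax_self] at h2
      exact absurd (Fin.le_last _) (not_le.2 h2)
    rcases Fin.eq_self_or_eq_succAbove p j with rfl | ⟨j, rfl⟩
    · rw [insertMax_self] at h1
      exact absurd (Fin.le_last _) (not_le.2 h1)
    rw [Fin.succAbove_lt_succAbove_iff] at hij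
    rcases Fin.eq_self_or_eq_succAbove p k with rfl | ⟨k, rfl⟩
    · have hj : j.val < k.val := by
        rw [Fin.succAbove_lt_iff_castSucc_lt] at hjk
        exact hjk
      simp at h1
      exact absurd (hp i j hij hj) (not_lt.2 h1.le)
    · exact h ⟨i, j, k, hij, by simpa using hjk, by simpa using h1, by simpa using h2⟩

theorem simsun_insertMax (p : Fin (n + 1)) (σ : Equiv.Perm (Fin n)) :
    Simsun (insertMax p σ) ↔
      Simsun σ ∧ ∀ i j : Fin n, i.val = p.val → j.val = i.val + 1 → σ i < σ j := by
  constructor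
  · intro h
    constructor
    · rintro k ⟨i, j, l, hij, hjl, hi, hj, hl, h1, h2, h3, h4⟩
      refine h (min k n) ⟨p.succAbove i, p.succAbove j, p.succAbove l, by simpa, by simpa,
        by simpa, by simpa, by simpa, by simpa, by simpa, ?_, ?_⟩
      · intro m
        rcases Fin.eq_self_or_eq_succAbove p m with rfl | ⟨m, rfl⟩
        · simp
        · intro ha hb
          have := h3 m (by simpa using ha) (by simpa using hb)
          simp [this]
      · intro m
        rcases Fin.eq_self_or_eq_succAbove p m with rfl | ⟨m, rfl⟩
        · simp
        · intro ha hb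
          have := h4 m (by simpa using ha) (by simpa using hb)
          simp [this]
    · intro i j hi hj
      by_contra hlt
      have hne : σ j ≠ σ i := fun h => by
        have := σ.injective h
        omega
      have ei : (p.succAbove i).val = p.val + 1 := by
        rw [Fin.succAbove_of_le_castSucc _ _ (by simp [Fin.le_def, hi])]
        simp [hi]
      have ej : (p.succAbove j).val = p.val + 2 := by
        rw [Fin.succAbove_of_le_castSucc _ _ (by simp [Fin.le_def]; omega)]
        simp; omega
      refine h (n + 1) ⟨p, p.succAbove i, p.succAbove j, ?_, ?_, by omega, by omega, by omega,
        ?_, ?_, ?_, ?_⟩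
      · rw [Fin.lt_def]; omega
      · rw [Fin.lt_def]; omega
      · simpa using lt_of_le_of_ne (not_lt.1 hlt) hne
      · simp [Fin.castSucc_lt_last]
      · intro m ha hb
        rw [Fin.lt_def] at ha hb
        omega
      · intro m ha hb
        rw [Fin.lt_def] at ha hb
        omega
  · rintro ⟨h, hp⟩ k ⟨i, j, l, hij, hjl, hi, hj, hl, h1, h2, h3, h4⟩
    rcases Fin.eq_self_or_eq_succAbove p j with rfl | ⟨j, rfl⟩
    · rw [insertMax_self] at h2
      exact absurd (Fin.le_last _) (not_le.2 h2)
    rcases Fin.eq_self_or_eq_succAbove p l with rfl | ⟨l, rfl⟩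
    · rw [insertMax_self] at h1
      exact absurd (Fin.le_last _) (not_le.2 h1)
    rw [Fin.succAbove_lt_succAbove_iff] at hjl
    rcases Fin.eq_self_or_eq_succAbove p i with rfl | ⟨i, rfl⟩
    · simp at hi h1
      have hj' : i ≤ j.castSucc := by
        rwa [Fin.lt_succAbove_iff_le_castSucc] at hij
      rw [Fin.le_def, Fin.val_castSucc] at hj'
      rw [Fin.lt_def] at hjl
      have ej : (i.succAbove j).val = j.val + 1 := by
        rw [Fin.succAbove_of_le_castSucc _ _ hj']; simp
      have el : (i.succAbove l).val = l.val + 1 := by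
        rw [Fin.succAbove_of_le_castSucc _ _ (by simp [Fin.le_def]; omega)]; simp
      have e1 : j.val = i.val := by
        by_contra hne
        have := h3 ⟨i.val + 1, by omega⟩ (by simp [Fin.lt_def]) (by simp [Fin.lt_def]; omega)
        omega
      have e2 : l.val = j.val + 1 := by
        by_contra hne
        have := h4 ⟨j.val + 2, by omega⟩ (by simp [Fin.lt_def]; omega) (by simp [Fin.lt_def]; omega)
        omega
      exact absurd (hp j l e1 e2) (not_lt.2 h1.le)
    · refine h k ⟨i, j, l, by simpa using hij, hjl, by simpa using hi, by simpa using hj,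
        by simpa using hl, by simpa using h1, by simpa using h2, ?_, ?_⟩
      · intro m ha hb
        simpa using h3 (p.succAbove m) (by simpa) (by simpa)
      · intro m ha hb
        simpa using h4 (p.succAbove m) (by simpa) (by simpa)

end Insertion

section GeneratingTree

/-- The label of a permutation in the generating tree: the position of the maximal value,
counted one further if the maximal value comes last. -/
def treeLabel : {n : ℕ} → Equiv.Perm (Fin n) → ℕ
  | 0, _ => 0
  | n + 1, σ => if σ.symm (Fin.last n) = Fin.last n then n + 1 else (σ.symm (Fin.last n)).val

theorem treeLabel_insertMax {n : ℕ} (p : Fin (n + 1)) (σ : Equiv.Perm (Fin n)) :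
    treeLabel (insertMax p σ) = if p.val = n then n + 1 else p.val := by
  have : (insertMax p σ).symm (Fin.last n) = p := by
    rw [Equiv.symm_apply_eq, insertMax_self]
  simp [treeLabel, this, Fin.ext_iff]

theorem treeLabel_eq_or_lt {n : ℕ} (σ : Equiv.Perm (Fin n)) :
    treeLabel σ = n ∨ treeLabel σ + 1 < n := by
  cases n with
  | zero => simp [treeLabel]
  | succ n =>
    simp only [treeLabel]
    split_ifs with h
    · exact Or.inl rfl
    · rw [Fin.ext_iff, Fin.val_last] at h
      omega

theorem insertion_site_iff {n : ℕ} (p : Fin (n + 1)) (σ : Equiv.Perm (Fin n)) (hs : Simsun σ)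
    (ha : Avoids213 σ) :
    ((∀ i j : Fin n, i.val = p.val → j.val = i.val + 1 → σ i < σ j) ∧
      ∀ i j : Fin n, i < j → j.val < p.val → σ i < σ j) ↔
    treeLabel σ = n ∨ p.val < treeLabel σ ∨ p.val = treeLabel σ + 1 := by
  cases n with
  | zero => simp [treeLabel]
  | succ n =>
    obtain ⟨q, hq⟩ : ∃ q, σ.symm (Fin.last n) = q := ⟨_, rfl⟩
    have hσq : σ q = Fin.last n := by rw [← hq, Equiv.apply_symm_apply]
    have hlt : ∀ i, i ≠ q → σ i < σ q := fun i hi => by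
      rw [hσq]
      exact Fin.lt_last_iff_ne_last.2 fun h => hi (σ.injective (h.trans hσq.symm))
    have hinc : ∀ i j, i < j → j ≤ q → σ i < σ j := by
      intro i j hij hjq
      rcases hjq.eq_or_lt with rfl | hjq
      · exact hlt i hij.ne
      · by_contra hn
        exact ha ⟨i, j, q, hij, hjq,
          lt_of_le_of_ne (not_lt.1 hn) fun h => hij.ne' (σ.injective h),
          hlt i (hij.trans hjq).ne⟩
    simp only [treeLabel, hq]
    split_ifs with hl
    · subst hl
      simp only [true_or, iff_true]
      exact ⟨fun i j _ h2 => hinc i j (by rw [Fin.lt_def]; omega) (Fin.le_last _),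
        fun i j h1 _ => hinc i j h1 (Fin.le_last _)⟩
    · have hqn : q.val < n := by
        have := Fin.lt_last_iff_ne_last.2 hl
        simpa [Fin.lt_def] using this
      have hnext : σ ⟨q.val + 1, by omega⟩ < σ q := hlt _ (by simp [Fin.ext_iff])
      constructor
      · rintro ⟨h1, h2⟩
        have hp1 : p.val ≤ q.val + 1 := by
          by_contra hcon
          exact lt_asymm hnext (h2 q ⟨q.val + 1, by omega⟩ (by simp [Fin.lt_def])
            (by simp; omega))
        have hp2 : p.val ≠ q.val := fun hcon =>
          lt_asymm hnext (h1 q ⟨q.val + 1, by omega⟩ hcon.symm rfl)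
        omega
      · intro h
        refine ⟨fun i j hi hj => ?_, fun i j hij hj => hinc i j hij (by rw [Fin.le_def]; omega)⟩
        rcases h with h | h | h
        · omega
        · exact hinc i j (by rw [Fin.lt_def]; omega) (by rw [Fin.le_def]; omega)
        · by_contra hn
          have hi' : i = ⟨q.val + 1, by omega⟩ := Fin.ext (hi.trans h)
          refine hs (n + 1) ⟨q, i, j, by rw [Fin.lt_def]; omega, by rw [Fin.lt_def]; omega,
            by omega, by omega, by omega, lt_of_le_of_ne (not_lt.1 hn) ?_, hi' ▸ hnext, ?_, ?_⟩
          · intro h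
            have := σ.injective h
            omega
          · intro m h1 h2
            rw [Fin.lt_def] at h1 h2
            omega
          · intro m h1 h2
            rw [Fin.lt_def] at h1 h2
            omega

theorem simsun_avoids213_insertMax {n : ℕ} (p : Fin (n + 1)) (σ : Equiv.Perm (Fin n)) :
    (Simsun (insertMax p σ) ∧ Avoids213 (insertMax p σ)) ↔ (Simsun σ ∧ Avoids213 σ) ∧
      (treeLabel σ = n ∨ p.val < treeLabel σ ∨ p.val = treeLabel σ + 1) := by
  rw [simsun_insertMax, avoids213_insertMax]
  constructor
  · rintro ⟨⟨h1, h2⟩, h3, h4⟩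
    exact ⟨⟨h1, h3⟩, (insertion_site_iff p σ h1 h3).1 ⟨h2, h4⟩⟩
  · rintro ⟨⟨h1, h3⟩, h⟩
    obtain ⟨h2, h4⟩ := (insertion_site_iff p σ h1 h3).2 h
    exact ⟨⟨h1, h2⟩, h3, h4⟩

theorem sum_insertion_sites {n ℓ : ℕ} (hℓ : ℓ = n ∨ ℓ + 1 < n) (φ : ℕ → ℕ) :
    (∑ p : Fin (n + 1), if ℓ = n ∨ p.val < ℓ ∨ p.val = ℓ + 1 then
      φ (if p.val = n then n + 1 else p.val) else 0) = treeTransfer φ ℓ := by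
  rw [Fin.sum_univ_eq_sum_range (fun p => if ℓ = n ∨ p < ℓ ∨ p = ℓ + 1 then
      φ (if p = n then n + 1 else p) else 0), treeTransfer]
  rcases hℓ with rfl | hlt
  · rw [Finset.sum_range_succ, add_comm]
    congr 1
    · simp
    · refine Finset.sum_congr rfl fun p hp => ?_
      rw [Finset.mem_range] at hp
      simp [hp.ne]
  · have hsites : (Finset.range (n + 1)).filter (fun p => ℓ = n ∨ p < ℓ ∨ p = ℓ + 1) =
        insert (ℓ + 1) (Finset.range ℓ) := by
      ext p
      simp only [Finset.mem_filter, Finset.mem_insert, Finset.mem_range]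
      omega
    rw [← Finset.sum_filter, hsites, Finset.sum_insert (by simp), if_neg hlt.ne]
    congr 1
    refine Finset.sum_congr rfl fun p hp => ?_
    rw [Finset.mem_range] at hp
    rw [if_neg (by omega)]

open scoped Classical in
theorem sum_simsun_avoids213_succ (n : ℕ) (φ : ℕ → ℕ) :
    (∑ σ : Equiv.Perm (Fin (n + 1)),
      if Simsun σ ∧ Avoids213 σ then φ (treeLabel σ) else 0) =
    ∑ σ : Equiv.Perm (Fin n),
      if Simsun σ ∧ Avoids213 σ then treeTransfer φ (treeLabel σ) else 0 := by
  rw [← insertMax_bijective.sum_comp, Fintype.sum_prod_type_right]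
  refine Finset.sum_congr rfl fun σ _ => ?_
  simp only [simsun_avoids213_insertMax, treeLabel_insertMax]
  split_ifs with h
  · rw [← sum_insertion_sites (treeLabel_eq_or_lt σ)]
    simp only [h, true_and, and_self]
  · simp only [h, false_and, if_false, Finset.sum_const_zero]

open scoped Classical in
theorem sum_simsun_avoids213 (n : ℕ) (φ : ℕ → ℕ) :
    (∑ σ : Equiv.Perm (Fin n), if Simsun σ ∧ Avoids213 σ then φ (treeLabel σ) else 0) =
      treeTransfer^[n] φ 0 := by
  induction n generalizing φ with
  | zero =>
    have h1 (σ : Equiv.Perm (Fin 0)) : Simsun σ := fun k ⟨i, _⟩ => i.elim0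
    have h2 (σ : Equiv.Perm (Fin 0)) : Avoids213 σ := fun ⟨i, _⟩ => i.elim0
    simp [h1, h2, treeLabel]
  | succ n ih => rw [sum_simsun_avoids213_succ, ih, Function.iterate_succ_apply]

end GeneratingTree

/-- The number of 213-avoiding simsun permutations in `S_n` equals the `n`-th
Motzkin number, i.e. the number of Motzkin paths of length `n`. -/
theorem card_simsun_avoid213_eq_motzkin (n : ℕ) :
    Nat.card {σ : Equiv.Perm (Fin n) // Simsun σ ∧ Avoids213 σ} =
      Nat.card {p : List ℤ // p.length = n ∧ MotzkinPath p} := by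
  classical
  rw [card_motzkinPath, Nat.card_eq_fintype_card, Fintype.card_subtype, Finset.card_filter,
    sum_simsun_avoids213 n fun _ => 1, iterate_treeTransfer_one]
  rfl
end

section
/- The number of 213-avoiding double simsun permutations in S_n equals the n-th secondary structure number S_n, i.e., the number of Motzkin paths of length n without two consecutive up steps. -/
open BinaryTree PowerSeries

/-! ### One-line words of permutations -/

lemma Avoids213.inv {n : ℕ} {σ : Equiv.Perm (Fin n)} (h : Avoids213 σ) : Avoids213 σ⁻¹ := by
  rintro ⟨i, j, k, hij, hjk, h1, h2⟩
  exact h ⟨σ⁻¹ j, σ⁻¹ i, σ⁻¹ k, h1, h2, by simpa using hij, by simpa using hjk⟩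

/-- For `213`-avoiding permutations, being simsun only has to be tested on the whole word. -/
lemma Avoids213.simsun_iff {n : ℕ} {σ : Equiv.Perm (Fin n)} (h : Avoids213 σ) :
    Simsun σ ↔ ∀ i (hi : i + 2 < n),
      ¬ (σ ⟨i + 2, hi⟩ < σ ⟨i + 1, by omega⟩ ∧ σ ⟨i + 1, by omega⟩ < σ ⟨i, by omega⟩) := by
  constructor
  · rintro hs i hi ⟨h1, h2⟩
    refine hs n ⟨⟨i, by omega⟩, ⟨i + 1, by omega⟩, ⟨i + 2, hi⟩, by simp, by simp, by simp, by simp,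
      by simp, h1, h2, fun m hm1 hm2 => ?_, fun m hm1 hm2 => ?_⟩ <;>
    · simp only [Fin.lt_def] at hm1 hm2
      omega
  · rintro hs k ⟨i, j, l, hij, hjl, hik, -, -, hlj, hji, hm1, hm2⟩
    have hl : j.val + 1 = l.val := by
      by_contra hne
      have hlt : j.val + 1 < l.val := by simp only [Fin.lt_def] at hjl; omega
      let m : Fin n := ⟨j.val + 1, by omega⟩
      have hjm : j < m := by simp [m, Fin.lt_def]
      have hkm := hm2 m hjm hlt
      exact h ⟨i, j, m, hij, hjm, hji, by simp only [Fin.lt_def]; omega⟩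
    let p : Fin n := ⟨j.val - 1, by omega⟩
    have hp : σ j < σ p := by
      rcases eq_or_ne i p with hip | hip
      · rwa [← hip]
      · have hlt : i < p := by
          simp only [Fin.lt_def, p, ne_eq, Fin.ext_iff] at hij hip ⊢
          omega
        have := hm1 p hlt (by simp only [Fin.lt_def, p] at hij ⊢; omega)
        simp only [Fin.lt_def] at hji ⊢
        omega
    have hj : j.val - 1 + 1 = j.val := by simp only [Fin.lt_def] at hij; omega
    refine hs (j.val - 1) (by omega) ⟨?_, ?_⟩
    · convert hlj using 2 <;> simp only [Fin.ext_iff] <;> omega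
    · convert hp using 2
      simp only [Fin.ext_iff]; omega

/-- The one-line word of a permutation of `Fin n`, with letters `0, …, n - 1`. -/
def permWord {n : ℕ} (σ : Equiv.Perm (Fin n)) : List ℕ := List.ofFn fun i => (σ i : ℕ)

/-- No three consecutive letters are decreasing. -/
def NoDoubleDescent (l : List ℕ) : Prop :=
  ∀ i (hi : i + 2 < l.length), ¬ (l[i + 2] < l[i + 1] ∧ l[i + 1] < l[i])

/-- No subsequence of the form `c + 2, c + 1, c`. -/
abbrev NoInverseDoubleDescent (l : List ℕ) : Prop :=
  l.Triplewise fun a b c => ¬ (a = b + 1 ∧ b = c + 1)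

/-- No subsequence ordered like `213`. -/
abbrev WordAvoids213 (l : List ℕ) : Prop :=
  l.Triplewise fun a b c => ¬ (b < a ∧ a < c)

lemma permWord_injective {n : ℕ} :
    Function.Injective (permWord : Equiv.Perm (Fin n) → List ℕ) := by
  intro σ τ h
  ext i
  exact congrFun (List.ofFn_injective h) i

lemma permWord_perm {n : ℕ} (σ : Equiv.Perm (Fin n)) : (permWord σ).Perm (List.range' 0 n) := by
  have hnd : (permWord σ).Nodup := List.nodup_ofFn.2 (Fin.val_injective.comp σ.injective)
  rw [List.perm_ext_iff_of_nodup hnd List.nodup_range']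
  intro a
  simp only [permWord, List.mem_ofFn, List.mem_range'_1]
  constructor
  · rintro ⟨i, rfl⟩
    simp
  · rintro ⟨-, h⟩
    exact ⟨σ⁻¹ ⟨a, by omega⟩, by simp⟩

lemma exists_permWord_eq {n : ℕ} {l : List ℕ} (h : l.Perm (List.range' 0 n)) :
    ∃ σ : Equiv.Perm (Fin n), permWord σ = l := by
  have hlen : l.length = n := by simpa using h.length_eq
  subst hlen
  have hnd : l.Nodup := h.nodup_iff.2 List.nodup_range'
  have hlt (i : Fin l.length) : l[i] < l.length := by
    simpa using h.mem_iff.1 (List.getElem_mem i.isLt)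
  have hinj : Function.Injective fun i : Fin l.length => (⟨l[i], hlt i⟩ : Fin l.length) := by
    intro i j hij
    simpa [hnd.getElem_inj_iff, Fin.ext_iff] using hij
  refine ⟨Equiv.ofBijective _ (Finite.injective_iff_bijective.1 hinj), ?_⟩
  refine List.ext_getElem (by simp [permWord]) fun i h1 h2 => ?_
  simp [permWord]

lemma avoids213_iff_permWord {n : ℕ} {σ : Equiv.Perm (Fin n)} :
    Avoids213 σ ↔ WordAvoids213 (permWord σ) := by
  simp only [WordAvoids213, List.triplewise_iff_getElem, permWord, List.getElem_ofFn,
    List.length_ofFn, Avoids213, Fin.val_fin_lt]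
  constructor
  · exact fun h i j k hij hjk hk hlt => h ⟨⟨i, by omega⟩, ⟨j, by omega⟩, ⟨k, hk⟩, hij, hjk, hlt⟩
  · rintro h ⟨i, j, k, hij, hjk, hlt⟩
    exact h i j k hij hjk k.isLt hlt

lemma Avoids213.simsun_iff_permWord {n : ℕ} {σ : Equiv.Perm (Fin n)} (h : Avoids213 σ) :
    Simsun σ ↔ NoDoubleDescent (permWord σ) := by
  simp [h.simsun_iff, NoDoubleDescent, permWord]

lemma Avoids213.simsun_inv_iff_permWord {n : ℕ} {σ : Equiv.Perm (Fin n)} (h : Avoids213 σ) :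
    Simsun σ⁻¹ ↔ NoInverseDoubleDescent (permWord σ) := by
  simp only [h.inv.simsun_iff, NoInverseDoubleDescent, List.triplewise_iff_getElem, permWord,
    List.getElem_ofFn, List.length_ofFn]
  constructor
  · rintro hs i j k hij hjk hk ⟨h1, h2⟩
    refine hs (σ ⟨k, hk⟩) (by have := (σ ⟨i, by omega⟩).isLt; omega) ?_
    have hi : (⟨σ ⟨k, hk⟩ + 2, by have := (σ ⟨i, by omega⟩).isLt; omega⟩ : Fin n)
      = σ ⟨i, by omega⟩ := by ext; simp only []; omega
    have hj : (⟨σ ⟨k, hk⟩ + 1, by have := (σ ⟨i, by omega⟩).isLt; omega⟩ : Fin n)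
      = σ ⟨j, by omega⟩ := by ext; simp only []; omega
    simp [hi, hj, hij, hjk]
  · rintro hs i hi ⟨h1, h2⟩
    exact hs _ _ _ h1 h2 (Fin.isLt _) (by simp)

/-! ### Words of binary trees -/

/-- The `213`-avoiding word on the letters `o, …, o + t.numNodes - 1` encoded by a binary tree:
the root is the first letter, the left subtree the larger letters, the right subtree the
smaller ones. -/
def treeWord : ℕ → BinaryTree Unit → List ℕ
  | _, .nil => []
  | o, .node _ l r => (o + r.numNodes) :: (treeWord (o + r.numNodes + 1) l ++ treeWord o r)

lemma treeWord_perm (o : ℕ) (t : BinaryTree Unit) :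
    (treeWord o t).Perm (List.range' o t.numNodes) := by
  induction t generalizing o with
  | nil => simp [treeWord]
  | node _ l r hl hr =>
    have h : List.range' o (l.numNodes + r.numNodes + 1) = List.range' o r.numNodes ++
        (o + r.numNodes) :: List.range' (o + r.numNodes + 1) l.numNodes := by
      rw [← List.range'_succ, List.range'_append_1]
      congr 1
      omega
    rw [treeWord, numNodes, h]
    exact (((hl _).append (hr _)).trans List.perm_append_comm |>.cons _).trans
      List.perm_middle.symm

lemma mem_treeWord {o a : ℕ} {t : BinaryTree Unit} :
    a ∈ treeWord o t ↔ o ≤ a ∧ a < o + t.numNodes := by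
  rw [(treeWord_perm o t).mem_iff, List.mem_range'_1]

@[simp]
lemma length_treeWord (o : ℕ) (t : BinaryTree Unit) :
    (treeWord o t).length = t.numNodes := by
  simpa using (treeWord_perm o t).length_eq

@[simp]
lemma treeWord_eq_nil {o : ℕ} {t : BinaryTree Unit} : treeWord o t = [] ↔ t = .nil := by
  cases t <;> simp [treeWord]

lemma treeWord_injective (o : ℕ) : Function.Injective (treeWord o) := by
  intro t s h
  induction t generalizing o s with
  | nil => exact (treeWord_eq_nil.1 h.symm).symm
  | node _ l r hl hr =>
    cases s with
    | nil => simp [treeWord] at h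
    | node _ l' r' =>
      have hlen := congrArg List.length h
      simp only [length_treeWord, numNodes] at hlen
      simp only [treeWord, List.cons.injEq, Nat.add_left_cancel_iff] at h
      obtain ⟨hr', h⟩ := h
      rw [hr'] at h
      obtain ⟨h1, h2⟩ := List.append_inj h (by simp; omega)
      rw [hl _ h1, hr _ h2]

lemma wordAvoids213_treeWord (o : ℕ) (t : BinaryTree Unit) : WordAvoids213 (treeWord o t) := by
  induction t generalizing o with
  | nil => simp [treeWord]
  | node _ l r hl hr =>
    simp only [treeWord, WordAvoids213, List.triplewise_cons, List.triplewise_append,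
      List.pairwise_append]
    refine ⟨⟨?_, ?_, ?_⟩, hl _, hr _, ?_, ?_⟩
    · exact List.pairwise_of_forall_mem_list fun a ha b hb => by grind [mem_treeWord]
    · exact List.pairwise_of_forall_mem_list fun a ha b hb => by grind [mem_treeWord]
    · grind [mem_treeWord]
    · exact fun x hx => List.pairwise_of_forall_mem_list fun a ha b hb => by grind [mem_treeWord]
    · exact fun x hx => List.pairwise_of_forall_mem_list fun a ha b hb => by grind [mem_treeWord]

lemma eq_filter_append_filter {a : ℕ} {l : List ℕ} (ha : a ∉ l)
    (h : l.Pairwise fun b c => ¬ (b < a ∧ a < c)) :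
    l = l.filter (a < ·) ++ l.filter (· < a) := by
  induction l with
  | nil => simp
  | cons x l ih =>
    simp only [List.mem_cons, not_or, List.pairwise_cons] at ha h
    have ih := ih ha.2 h.2
    rcases lt_or_gt_of_ne ha.1 with hlt | hlt
    · simp [hlt, hlt.not_gt, ← ih]
    · have h0 : l.filter (a < ·) = [] := by
        simp only [List.filter_eq_nil_iff, decide_eq_true_eq]
        exact fun c hc hac => h.1 c hc ⟨hlt, hac⟩
      rw [h0, List.nil_append] at ih
      simp [hlt, hlt.not_gt, h0, ← ih]

lemma exists_treeWord_eq {o n : ℕ} {w : List ℕ} (hw : w.Perm (List.range' o n))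
    (h : WordAvoids213 w) : ∃ t, treeWord o t = w := by
  induction hn : n using Nat.strong_induction_on generalizing o n w with
  | _ k ih =>
    subst hn
    cases w with
    | nil => exact ⟨.nil, rfl⟩
    | cons a w =>
      have hnd : (a :: w).Nodup := hw.nodup_iff.2 List.nodup_range'
      have hmem (x : ℕ) : x = a ∨ x ∈ w ↔ o ≤ x ∧ x < o + n := by
        rw [← List.mem_cons, hw.mem_iff, List.mem_range'_1]
      rw [List.nodup_cons] at hnd
      have ha := (hmem a).1 (Or.inl rfl)
      rw [WordAvoids213, List.triplewise_cons] at h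
      have hsplit := eq_filter_append_filter hnd.1 h.1
      have h2 := h.2
      rw [hsplit, List.triplewise_append] at h2
      have hL : (w.filter (a < ·)).Perm (List.range' (a + 1) (o + n - (a + 1))) := by
        rw [List.perm_ext_iff_of_nodup (hnd.2.filter _) List.nodup_range']
        intro x
        have := hmem x
        simp only [List.mem_filter, List.mem_range'_1, decide_eq_true_eq]
        constructor
        · rintro ⟨h1, h2⟩
          have := this.1 (Or.inr h1)
          omega
        · intro h1
          exact ⟨(this.2 (by omega)).resolve_left (by omega), by omega⟩
      have hS : (w.filter (· < a)).Perm (List.range' o (a - o)) := by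
        rw [List.perm_ext_iff_of_nodup (hnd.2.filter _) List.nodup_range']
        intro x
        have := hmem x
        simp only [List.mem_filter, List.mem_range'_1, decide_eq_true_eq]
        constructor
        · rintro ⟨h1, h2⟩
          have := this.1 (Or.inr h1)
          omega
        · intro h1
          exact ⟨(this.2 (by omega)).resolve_left (by omega), by omega⟩
      obtain ⟨l, hl⟩ := ih _ (by omega) hL h2.1 rfl
      obtain ⟨r, hr⟩ := ih _ (by omega) hS h2.2.1 rfl
      have hrn : r.numNodes = a - o := by
        rw [← length_treeWord o r, hr, hS.length_eq, List.length_range']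
      refine ⟨.node () l r, ?_⟩
      have hoa : o + (a - o) = a := by omega
      rw [treeWord, hrn, hoa, hl, hr, ← hsplit]

/-! ### Descents of words of binary trees -/

/-- The last two letters form a descent. -/
def EndsWithDescent (l : List ℕ) : Prop :=
  ∃ i, ∃ hi : i + 2 = l.length, l[i + 1] < l[i]

/-- The first two letters form a descent. -/
def StartsWithDescent (l : List ℕ) : Prop :=
  ∃ h : 2 ≤ l.length, l[1] < l[0]

lemma noDoubleDescent_cons_append {a : ℕ} {l m : List ℕ} (hl : ∀ x ∈ l, a < x)
    (hm : ∀ x ∈ m, x < a) :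
    NoDoubleDescent (a :: (l ++ m)) ↔ NoDoubleDescent l ∧ NoDoubleDescent m ∧
      ¬ StartsWithDescent m ∧ (m ≠ [] → ¬ EndsWithDescent l) := by
  replace hl : ∀ i (hi : i < l.length), a < l[i] := fun i hi => hl _ (List.getElem_mem hi)
  replace hm : ∀ i (hi : i < m.length), m[i] < a := fun i hi => hm _ (List.getElem_mem hi)
  constructor
  · intro h
    refine ⟨fun i hi => ?_, fun i hi => ?_, ?_, ?_⟩
    · have := h (i + 1) (by simp; omega)
      grind
    · have := h (l.length + 1 + i) (by simp; omega)
      grind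
    · rintro ⟨h2, hlt⟩
      have hfirst : m[0] < (a :: (l ++ m))[l.length] := by
        have := hm 0 (by omega)
        rcases l with _ | ⟨x, l⟩
        · simpa using this
        · have := hl l.length (by simp)
          grind
      have := h l.length (by simp; omega)
      simp only [List.getElem_cons_succ, List.getElem_append_right, Nat.le_succ, le_refl,
        Nat.sub_self, Nat.add_sub_cancel_left, not_and] at this
      exact this hlt hfirst
    · rintro hm' ⟨i, hi, hlt⟩
      have := List.length_pos_iff.2 hm'
      have := h (i + 1) (by simp; omega)
      grind
  · rintro ⟨h1, h2, h3, h4⟩ i hi ⟨hlt1, hlt2⟩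
    simp only [List.length_cons, List.length_append] at hi
    rcases lt_trichotomy i l.length with hi' | rfl | hi'
    · obtain _ | i := i
      · grind
      · by_cases hil : i + 2 < l.length
        · have := h1 i hil
          grind
        · refine h4 (by grind) ⟨i, by omega, ?_⟩
          grind
    · exact h3 ⟨by omega, by grind⟩
    · obtain ⟨j, rfl⟩ := Nat.exists_eq_add_of_lt hi'
      have := h2 j (by omega)
      grind

lemma endsWithDescent_cons_append {a : ℕ} {l m : List ℕ} (hl : ∀ x ∈ l, a < x)
    (hm : ∀ x ∈ m, x < a) :
    EndsWithDescent (a :: (l ++ m)) ↔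
      m = [] ∧ EndsWithDescent l ∨ m.length = 1 ∨ EndsWithDescent m := by
  replace hl : ∀ i (hi : i < l.length), a < l[i] := fun i hi => hl _ (List.getElem_mem hi)
  replace hm : ∀ i (hi : i < m.length), m[i] < a := fun i hi => hm _ (List.getElem_mem hi)
  constructor
  · rintro ⟨i, hi, hlt⟩
    simp only [List.length_cons, List.length_append] at hi
    rcases Nat.lt_trichotomy m.length 1 with hm1 | hm1 | hm1
    · obtain rfl : m = [] := by simpa using hm1
      obtain _ | i := i
      · grind
      · exact Or.inl ⟨rfl, i, by simpa using hi, by grind⟩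
    · exact Or.inr (Or.inl hm1)
    · refine Or.inr (Or.inr ⟨m.length - 2, by omega, ?_⟩)
      grind
  · rintro (⟨rfl, i, hi, hlt⟩ | h1 | ⟨i, hi, hlt⟩)
    · exact ⟨i + 1, by simpa using hi, by grind⟩
    · refine ⟨l.length, by simp [h1], ?_⟩
      have := hm 0 (by omega)
      simp only [List.getElem_cons_succ, List.getElem_append_right, le_refl, Nat.sub_self]
      rcases l with _ | ⟨x, l⟩
      · simpa using this
      · have := hl l.length (by simp)
        grind
    · exact ⟨l.length + 1 + i, by simp; omega, by grind⟩

namespace BinaryTree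

/-- The last two letters of the word of the tree form a descent. -/
def EndDescent : BinaryTree Unit → Prop
  | .nil => False
  | .node _ l r => r = .nil ∧ l.EndDescent ∨ r.numNodes = 1 ∨ r.EndDescent

/-- The largest letter of the word of the tree precedes the second largest one. -/
def TopDescent : BinaryTree Unit → Prop
  | .nil => False
  | .node _ l r => l = .nil ∧ r ≠ .nil ∨ l.TopDescent

/-- The word of the tree has neither double descents nor inverse double descents. -/
def NoDoubleDescents : BinaryTree Unit → Prop
  | .nil => True
  | .node _ l r => l.NoDoubleDescents ∧ r.NoDoubleDescents ∧ ¬ r.TopDescent ∧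
      (r ≠ .nil → ¬ l.EndDescent)

end BinaryTree

lemma lt_of_mem_treeWord_left {o x : ℕ} {l r : BinaryTree Unit}
    (h : x ∈ treeWord (o + r.numNodes + 1) l) : o + r.numNodes < x :=
  (mem_treeWord.1 h).1

lemma lt_of_mem_treeWord_right {o x : ℕ} {r : BinaryTree Unit}
    (h : x ∈ treeWord o r) : x < o + r.numNodes :=
  (mem_treeWord.1 h).2

lemma endsWithDescent_treeWord {o : ℕ} {t : BinaryTree Unit} :
    EndsWithDescent (treeWord o t) ↔ t.EndDescent := by
  induction t generalizing o with
  | nil => simp [treeWord, EndsWithDescent, EndDescent]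
  | node _ l r hl hr =>
    rw [treeWord, endsWithDescent_cons_append (fun _ => lt_of_mem_treeWord_left)
      (fun _ => lt_of_mem_treeWord_right), EndDescent, hl, hr, treeWord_eq_nil, length_treeWord]

lemma pairwise_treeWord_top {o : ℕ} {t : BinaryTree Unit} :
    (treeWord o t).Pairwise (fun a b => ¬ (a + 1 = o + t.numNodes ∧ a = b + 1)) ↔
      ¬ t.TopDescent := by
  induction t generalizing o with
  | nil => simp [treeWord, TopDescent]
  | node _ l r hl hr =>
    have hl := hl (o := o + r.numNodes + 1)
    have heq : o + r.numNodes + 1 + l.numNodes = o + (l.numNodes + r.numNodes + 1) := by omega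
    rw [heq] at hl
    rw [treeWord, numNodes, List.pairwise_cons, List.pairwise_append, hl, TopDescent, not_or]
    have h1 : (∀ b ∈ treeWord (o + r.numNodes + 1) l ++ treeWord o r,
        ¬ (o + r.numNodes + 1 = o + (l.numNodes + r.numNodes + 1) ∧ o + r.numNodes = b + 1)) ↔
        ¬ (l = .nil ∧ r ≠ .nil) := by
      constructor
      · rintro h ⟨rfl, hr⟩
        have : r.numNodes ≠ 0 := by cases r <;> simp_all
        refine h (o + r.numNodes - 1) ?_ ⟨by simp only [numNodes]; omega, by omega⟩
        simp only [List.mem_append, mem_treeWord]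
        omega
      · rintro h b hb ⟨h2, h3⟩
        obtain rfl : l = .nil := by
          cases l with
          | nil => rfl
          | node _ l1 l2 => simp only [numNodes] at h2; omega
        refine h ⟨rfl, ?_⟩
        rintro rfl
        simp [treeWord] at hb
    rw [h1]
    refine and_congr_right fun _ => ⟨And.left, fun h => ⟨h, ?_, ?_⟩⟩
    · exact List.pairwise_of_forall_mem_list fun a ha b hb => by grind [mem_treeWord]
    · grind [mem_treeWord]

lemma topDescent_of_startsWithDescent {o : ℕ} {t : BinaryTree Unit}
    (h : StartsWithDescent (treeWord o t)) : t.TopDescent := by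
  obtain ⟨h2, h⟩ := h
  cases t with
  | nil => simp [treeWord] at h2
  | node _ l r =>
    refine Or.inl ?_
    cases l with
    | nil =>
      refine ⟨rfl, ?_⟩
      rintro rfl
      simp at h2
    | node _ l1 l2 =>
      simp only [treeWord] at h
      grind

lemma noDoubleDescent_treeWord {o : ℕ} {t : BinaryTree Unit} :
    NoDoubleDescent (treeWord o t) ∧ NoInverseDoubleDescent (treeWord o t) ↔
      t.NoDoubleDescents := by
  induction t generalizing o with
  | nil => simp [treeWord, NoDoubleDescent, NoDoubleDescents]
  | node _ l r hl hr =>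
    rw [treeWord, noDoubleDescent_cons_append (fun _ => lt_of_mem_treeWord_left)
      (fun _ => lt_of_mem_treeWord_right), endsWithDescent_treeWord, NoDoubleDescents, ← hl, ← hr,
      NoInverseDoubleDescent, List.triplewise_cons, List.triplewise_append, ← pairwise_treeWord_top,
      ne_eq, treeWord_eq_nil, List.pairwise_append]
    have h1 : (treeWord o r).Pairwise
        (fun b c => ¬ (o + r.numNodes = b + 1 ∧ b = c + 1)) ↔
        (treeWord o r).Pairwise (fun a b => ¬ (a + 1 = o + r.numNodes ∧ a = b + 1)) := by
      simp only [eq_comm]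
    rw [h1]
    constructor
    · tauto
    · rintro ⟨⟨h2, h3⟩, ⟨h4, h5⟩, h6, h7⟩
      refine ⟨⟨h2, h4, fun h => pairwise_treeWord_top.1 h6 (topDescent_of_startsWithDescent h), h7⟩,
        ⟨?_, h6, ?_⟩, h3, h5, ?_, ?_⟩
      · exact List.pairwise_of_forall_mem_list fun a ha b hb => by grind [mem_treeWord]
      · grind [mem_treeWord]
      · exact fun x hx => List.pairwise_of_forall_mem_list fun a ha b hb => by
          grind [mem_treeWord]
      · exact fun x hx => List.pairwise_of_forall_mem_list fun a ha b hb => by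
          grind [mem_treeWord]

/-- Double simsun `213`-avoiding permutations are encoded by binary trees. -/
lemma card_doubleSimsun_avoids213 (n : ℕ) :
    Nat.card {σ : Equiv.Perm (Fin n) // DoubleSimsun σ ∧ Avoids213 σ} =
      {t : BinaryTree Unit | t.NoDoubleDescents ∧ t.numNodes = n}.ncard := by
  have himage : permWord '' {σ : Equiv.Perm (Fin n) | DoubleSimsun σ ∧ Avoids213 σ} =
      treeWord 0 '' {t | t.NoDoubleDescents ∧ t.numNodes = n} := by
    ext w
    constructor
    · rintro ⟨σ, ⟨⟨h1, h2⟩, h3⟩, rfl⟩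
      rw [h3.simsun_iff_permWord] at h1
      rw [h3.simsun_inv_iff_permWord] at h2
      obtain ⟨t, ht⟩ := exists_treeWord_eq (permWord_perm σ) (avoids213_iff_permWord.1 h3)
      refine ⟨t, ⟨?_, ?_⟩, ht⟩
      · rw [← noDoubleDescent_treeWord (o := 0), ht]
        exact ⟨h1, h2⟩
      · rw [← length_treeWord 0 t, ht, permWord, List.length_ofFn]
    · rintro ⟨t, ⟨ht, rfl⟩, rfl⟩
      obtain ⟨σ, hσ⟩ := exists_permWord_eq (treeWord_perm 0 t)
      have h3 : Avoids213 σ := by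
        rw [avoids213_iff_permWord, hσ]
        exact wordAvoids213_treeWord 0 t
      rw [← noDoubleDescent_treeWord (o := 0), ← hσ] at ht
      exact ⟨σ, ⟨⟨h3.simsun_iff_permWord.2 ht.1, h3.simsun_inv_iff_permWord.2 ht.2⟩, h3⟩, hσ⟩
  rw [← Set.ncard_image_of_injective _ (treeWord_injective 0), ← himage,
    Set.ncard_image_of_injective _ permWord_injective]
  rfl

/-! ### Generating series of combinatorial classes -/

section GenSeries

variable {α β γ : Type*}

/-- The generating series of the elements of `s`, counted by the size `w`. -/
noncomputable def genSeries (w : α → ℕ) (s : Set α) : ℤ⟦X⟧ :=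
  .mk fun n => ({a | a ∈ s ∧ w a = n}.ncard : ℤ)

/-- There are finitely many elements of `s` of any given size. -/
def FiniteFibers (w : α → ℕ) (s : Set α) : Prop := ∀ n, {a | a ∈ s ∧ w a = n}.Finite

lemma FiniteFibers.mono {w : α → ℕ} {s t : Set α} (h : FiniteFibers w t) (hst : s ⊆ t) :
    FiniteFibers w s :=
  fun n => (h n).subset fun _ ha => ⟨hst ha.1, ha.2⟩

lemma genSeries_union {w : α → ℕ} {s t : Set α} (h : FiniteFibers w (s ∪ t))
    (hd : Disjoint s t) : genSeries w (s ∪ t) = genSeries w s + genSeries w t := by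
  ext n
  simp only [genSeries, coeff_mk, map_add]
  have heq : {a | a ∈ s ∪ t ∧ w a = n} = {a | a ∈ s ∧ w a = n} ∪ {a | a ∈ t ∧ w a = n} := by
    ext a
    simp only [Set.mem_union, Set.mem_ofPred_eq]
    tauto
  rw [heq, Set.ncard_union_eq (hd.mono (fun _ h => h.1) fun _ h => h.1)
    (h.mono Set.subset_union_left n) (h.mono Set.subset_union_right n)]
  push_cast
  rfl

lemma genSeries_singleton {w : α → ℕ} {a : α} (ha : w a = 0) : genSeries w {a} = 1 := by
  ext n
  simp only [genSeries, coeff_mk, coeff_one, Set.mem_singleton_iff]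
  split_ifs with hn
  · have : {b | b = a ∧ w b = n} = {a} := by ext; simp; grind
    simp [this]
  · have : {b | b = a ∧ w b = n} = ∅ := by ext; simp; grind
    simp [this]

lemma genSeries_image {w : α → ℕ} {v : β → ℕ} {f : α → β} (hf : Function.Injective f)
    (hw : ∀ a, v (f a) = w a + 1) (s : Set α) :
    genSeries v (f '' s) = X * genSeries w s := by
  ext n
  cases n with
  | zero =>
    rw [coeff_zero_X_mul]
    simp only [genSeries, coeff_mk]
    have : {b | b ∈ f '' s ∧ v b = 0} = ∅ := by
      ext b
      simp only [Set.mem_ofPred_eq, Set.mem_empty_iff_false, iff_false]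
      rintro ⟨⟨a, -, rfl⟩, h⟩
      simp [hw] at h
    rw [this, Set.ncard_empty, Nat.cast_zero]
  | succ n =>
    rw [coeff_succ_X_mul]
    simp only [genSeries, coeff_mk]
    rw [← Set.ncard_image_of_injective _ hf]
    congr 2
    ext b
    constructor
    · rintro ⟨⟨a, ha, rfl⟩, h⟩
      exact ⟨a, ⟨ha, by simpa [hw] using h⟩, rfl⟩
    · rintro ⟨a, ⟨ha, rfl⟩, rfl⟩
      exact ⟨⟨a, ha, rfl⟩, hw a⟩

lemma genSeries_prod {w : α → ℕ} {v : β → ℕ} {s : Set α} {t : Set β}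
    (hs : FiniteFibers w s) (ht : FiniteFibers v t) :
    genSeries (fun p : α × β => w p.1 + v p.2) (s ×ˢ t) = genSeries w s * genSeries v t := by
  classical
  ext n
  rw [coeff_mul]
  simp only [genSeries, coeff_mk]
  have heq : {p : α × β | p ∈ s ×ˢ t ∧ w p.1 + v p.2 = n} =
      ((Finset.HasAntidiagonal.antidiagonal n).biUnion fun k => (hs k.1).toFinset ×ˢ (ht k.2).toFinset :
        Finset (α × β)) := by
    ext ⟨a, b⟩
    simp
    grind
  rw [heq, Set.ncard_coe_finset, Finset.card_biUnion]
  · simp [Finset.card_product, Set.ncard_eq_toFinset_card _ (hs _),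
      Set.ncard_eq_toFinset_card _ (ht _)]
  · intro k _ k' _ hne
    change Disjoint _ _
    rw [Finset.disjoint_left]
    rintro ⟨a, b⟩
    simp only [Finset.mem_product, Set.Finite.mem_toFinset, Set.mem_ofPred_eq]
    rintro ⟨⟨-, h1⟩, -, h2⟩ ⟨⟨-, h3⟩, -, h4⟩
    exact hne (Prod.ext (h1.symm.trans h3) (h2.symm.trans h4))

end GenSeries

/-! ### Counting binary trees -/

namespace BinaryTree

/-- The generating series of a set of binary trees, counted by the number of nodes. -/
noncomputable abbrev series (s : Set (BinaryTree Unit)) : ℤ⟦X⟧ := genSeries numNodes s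

/-- Trees whose left and right subtrees belong to given sets. -/
def join (s t : Set (BinaryTree Unit)) : Set (BinaryTree Unit) :=
  (fun p => node () p.1 p.2) '' s ×ˢ t

lemma finiteFibers (s : Set (BinaryTree Unit)) : FiniteFibers numNodes s := fun n =>
  (Finset.finite_toSet (treesOfNumNodesEq n)).subset fun t ht => by simpa using ht.2

lemma series_union {s t : Set (BinaryTree Unit)} (h : Disjoint s t) :
    series (s ∪ t) = series s + series t :=
  genSeries_union (finiteFibers _) h

lemma series_join (s t : Set (BinaryTree Unit)) :
    series (join s t) = X * (series s * series t) := by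
  have hinj : Function.Injective fun p : BinaryTree Unit × BinaryTree Unit =>
      node () p.1 p.2 := by
    rintro ⟨a, b⟩ ⟨c, d⟩ h
    simpa using h
  rw [← genSeries_prod (finiteFibers s) (finiteFibers t)]
  exact genSeries_image hinj (fun _ => rfl) _

lemma series_nil : series {nil} = 1 := genSeries_singleton rfl

@[simp]
lemma nil_notMem_join {s t : Set (BinaryTree Unit)} : nil ∉ join s t := by
  simp [join]

@[simp]
lemma node_mem_join {s t : Set (BinaryTree Unit)} {l r : BinaryTree Unit} {u : Unit} :
    node u l r ∈ join s t ↔ l ∈ s ∧ r ∈ t := by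
  simp [join]

lemma disjoint_join {s t s' t' : Set (BinaryTree Unit)} (h : Disjoint t t') :
    Disjoint (join s t) (join s' t') := by
  rw [Set.disjoint_left]
  rintro (_ | ⟨_, l, r⟩) h1 h2
  · simp at h1
  · rw [node_mem_join] at h1 h2
    exact Set.disjoint_left.1 h h1.2 h2.2

lemma numNodes_eq_one {t : BinaryTree Unit} : t.numNodes = 1 ↔ t = node () nil nil := by
  cases t with
  | nil => simp
  | node _ l r => cases l <;> cases r <;> simp

/-- Trees without double descents. -/
def classD : Set (BinaryTree Unit) := {t | t.NoDoubleDescents}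

/-- Trees without double descents and without final descent. -/
def classE : Set (BinaryTree Unit) := {t | t.NoDoubleDescents ∧ ¬ t.EndDescent}

/-- Nonempty trees without double descents and without descent at the top. -/
def classT : Set (BinaryTree Unit) := {t | t ≠ nil ∧ t.NoDoubleDescents ∧ ¬ t.TopDescent}

/-- Nonempty trees without double descents, final descent or descent at the top. -/
def classB : Set (BinaryTree Unit) := classT ∩ classE

/-- The elements of `classB` with at least two nodes. -/
def classB₂ : Set (BinaryTree Unit) := classB \ {node () nil nil}

lemma classD_eq : classD = {nil} ∪ (join classD {nil} ∪ join classE classT) := by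
  ext t
  cases t with
  | nil => simp [classD, NoDoubleDescents]
  | node _ l r =>
    by_cases hr : r = nil <;>
      simp [hr, classD, classE, classT, NoDoubleDescents, TopDescent] <;> tauto

lemma classE_eq : classE = {nil} ∪ (join classE {nil} ∪ join classE classB₂) := by
  ext t
  cases t with
  | nil => simp [classE, NoDoubleDescents, EndDescent]
  | node _ l r =>
    by_cases hr : r = nil
    · simp [hr, classE, classT, classB, classB₂, NoDoubleDescents, TopDescent, EndDescent]
    · simp [hr, classE, classT, classB, classB₂, NoDoubleDescents, EndDescent, numNodes_eq_one]
      tauto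

lemma classT_eq : classT = join {nil} {nil} ∪ (join classT {nil} ∪ join classB classT) := by
  ext t
  cases t with
  | nil => simp [classT]
  | node _ l r =>
    by_cases hr : r = nil <;> by_cases hl : l = nil <;>
      simp [hl, hr, classE, classT, classB, NoDoubleDescents, TopDescent] <;> tauto

lemma classB_eq : classB = join {nil} {nil} ∪ (join classB {nil} ∪ join classB classB₂) := by
  ext t
  cases t with
  | nil => simp [classB, classT]
  | node _ l r =>
    by_cases hr : r = nil <;> by_cases hl : l = nil <;>
      simp [hl, hr, classE, classT, classB, classB₂, NoDoubleDescents, TopDescent, EndDescent,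
        numNodes_eq_one] <;> tauto

lemma classB_eq_union : classB = join {nil} {nil} ∪ classB₂ := by
  have h : join {nil} {nil} = {node () nil nil} := by
    ext t
    cases t <;> simp
  rw [h, classB₂, Set.union_sdiff_cancel]
  simp [classB, classT, classE, NoDoubleDescents, TopDescent, EndDescent]

lemma disjoint_nil_join {s t : Set (BinaryTree Unit)} : Disjoint {nil} (join s t) := by
  simp

lemma disjoint_nil_classT : Disjoint {nil} classT := by
  simp [classT]

lemma disjoint_nil_classB₂ : Disjoint {nil} classB₂ := by
  simp [classB₂, classB, classT]

lemma disjoint_leaf_join {s t : Set (BinaryTree Unit)} (hs : nil ∉ s) :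
    Disjoint (join {nil} {nil}) (join s t) := by
  rw [Set.disjoint_left]
  rintro (_ | ⟨_, l, r⟩) h1 h2
  · simp at h1
  · rw [node_mem_join] at h1 h2
    exact hs (h1.1 ▸ h2.1)

lemma nil_notMem_classT : nil ∉ classT := by simp [classT]

lemma nil_notMem_classB : nil ∉ classB := by simp [classB, classT]

lemma series_classD :
    series classD = 1 + (X * series classD + X * (series classE * series classT)) := by
  conv_lhs => rw [classD_eq]
  rw [series_union (Set.disjoint_union_right.2 ⟨disjoint_nil_join, disjoint_nil_join⟩),
    series_union (disjoint_join disjoint_nil_classT), series_join, series_join, series_nil, mul_one]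

lemma series_classE :
    series classE = 1 + (X * series classE + X * (series classE * series classB₂)) := by
  conv_lhs => rw [classE_eq]
  rw [series_union (Set.disjoint_union_right.2 ⟨disjoint_nil_join, disjoint_nil_join⟩),
    series_union (disjoint_join disjoint_nil_classB₂), series_join, series_join, series_nil,
    mul_one]

lemma series_classT :
    series classT = X + (X * series classT + X * (series classB * series classT)) := by
  conv_lhs => rw [classT_eq]
  rw [series_union (Set.disjoint_union_right.2
      ⟨disjoint_leaf_join nil_notMem_classT, disjoint_leaf_join nil_notMem_classB⟩),
    series_union (disjoint_join disjoint_nil_classT), series_join, series_join, series_join,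
    series_nil, mul_one, mul_one, mul_one]

lemma series_classB :
    series classB = X + (X * series classB + X * (series classB * series classB₂)) := by
  conv_lhs => rw [classB_eq]
  rw [series_union (Set.disjoint_union_right.2
      ⟨disjoint_leaf_join nil_notMem_classB, disjoint_leaf_join nil_notMem_classB⟩),
    series_union (disjoint_join disjoint_nil_classB₂), series_join, series_join, series_join,
    series_nil, mul_one, mul_one, mul_one]

lemma series_classB_eq_add : series classB = X + series classB₂ := by
  conv_lhs => rw [classB_eq_union]
  have h : Disjoint (join {nil} {nil}) classB₂ := by
    rw [Set.disjoint_left]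
    rintro (_ | ⟨_, l, r⟩) h1 h2
    · simp at h1
    · obtain ⟨rfl, rfl⟩ := node_mem_join.1 h1
      exact h2.2 rfl
  rw [series_union h, series_join, series_nil, mul_one, mul_one]

lemma one_sub_X_mul_ne_zero (f : ℤ⟦X⟧) : 1 - X * f ≠ 0 := by
  intro h
  simpa using congrArg constantCoeff h

/-- The functional equation of the secondary structure numbers. -/
lemma series_classD_eq :
    series classD = 1 + X * series classD +
      X ^ 2 * (1 + X * series classD) * series classD := by
  have hD := series_classD
  have hE := series_classE
  have hT := series_classT
  have hB := series_classB
  have hB₂ := series_classB_eq_add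
  set d := series classD
  set e := series classE
  set t := series classT
  set b := series classB
  set c := series classB₂
  have h1 : b = X * e := by
    refine mul_left_cancel₀ (one_sub_X_mul_ne_zero (1 + c)) ?_
    linear_combination hB - X * hE
  have h2 : t = X * d := by
    refine mul_left_cancel₀ (one_sub_X_mul_ne_zero 1) ?_
    linear_combination hT - X * hD + X * t * h1
  have h3 : e = 1 + X * d := by
    refine mul_left_cancel₀ (one_sub_X_mul_ne_zero (1 + b)) ?_
    linear_combination hE - hT - X * e * hB₂ + X * h1 + (1 - X - X * b) * h2
  linear_combination hD + X * e * h2 + X ^ 2 * d * h3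

end BinaryTree

/-! ### Counting Motzkin paths -/

section MotzkinSeries

/-- Motzkin paths from height `h` to height `0` without consecutive up steps. -/
def pathsFrom (h : ℕ) : Set (List ℤ) :=
  {p | (∀ s ∈ p, s = 1 ∨ s = -1 ∨ s = 0) ∧ (∀ t, t <+: p → 0 ≤ (h : ℤ) + t.sum) ∧
    (h : ℤ) + p.sum = 0 ∧ UUFree p}

/-- The elements of `pathsFrom h` that do not start with an up step. -/
def pathsFromAfterUp (h : ℕ) : Set (List ℤ) := {p | p ∈ pathsFrom h ∧ UUFree (1 :: p)}

lemma uuFree_nil : UUFree [] := by simp [UUFree]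

lemma uuFree_cons {a : ℤ} (ha : a ≠ 1) {p : List ℤ} : UUFree (a :: p) ↔ UUFree p := by
  simp [UUFree, List.infix_cons_iff, ha.symm]

lemma uuFree_one_cons_cons {a : ℤ} {p : List ℤ} :
    UUFree (1 :: a :: p) ↔ a ≠ 1 ∧ UUFree (a :: p) := by
  rw [UUFree, List.infix_cons_iff, not_or, ← UUFree]
  simp [eq_comm]

lemma UUFree.of_cons {a : ℤ} {p : List ℤ} (h : UUFree (a :: p)) : UUFree p :=
  fun h' => h (List.infix_cons h')

lemma finiteFibers_pathsFrom (h : ℕ) : FiniteFibers List.length (pathsFrom h) := by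
  intro n
  refine ((List.finite_length_eq (Fin 3) n).image
    (List.map fun i : Fin 3 => ((i : ℕ) : ℤ) - 1)).subset ?_
  rintro p ⟨⟨hp, -⟩, rfl⟩
  refine ⟨p.map fun s => if s = 1 then 2 else if s = 0 then 1 else 0, by simp, ?_⟩
  rw [List.map_map]
  refine (List.map_congr_left fun s hs => ?_).trans (List.map_id p)
  rcases hp s hs with rfl | rfl | rfl <;> simp

lemma nil_mem_pathsFrom {h : ℕ} : [] ∈ pathsFrom h ↔ h = 0 := by
  simp [pathsFrom, uuFree_nil]

lemma cons_mem_pathsFrom {h k : ℕ} {a : ℤ} {p : List ℤ} (hk : (k : ℤ) = h + a) :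
    a :: p ∈ pathsFrom h ↔
      (a = 1 ∨ a = -1 ∨ a = 0) ∧ p ∈ pathsFrom k ∧ UUFree (a :: p) := by
  have hpre : (∀ t, t <+: a :: p → 0 ≤ (h : ℤ) + t.sum) ↔
      ∀ t, t <+: p → 0 ≤ (k : ℤ) + t.sum := by
    constructor
    · intro H t ht
      have := H (a :: t) (by simpa using ht)
      rw [List.sum_cons] at this
      lia
    · intro H t ht
      rcases List.prefix_cons_iff.1 ht with rfl | ⟨t, rfl, ht'⟩
      · simp
      · have := H t ht'
        rw [List.sum_cons]
        lia
  have hsum : (h : ℤ) + (a :: p).sum = 0 ↔ (k : ℤ) + p.sum = 0 := by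
    rw [List.sum_cons, hk, add_assoc]
  have huu : UUFree (a :: p) → UUFree p := UUFree.of_cons
  simp only [pathsFrom, Set.mem_ofPred_eq, hpre, hsum, List.forall_mem_cons]
  tauto

lemma neg_one_cons_notMem_pathsFrom_zero {p : List ℤ} : -1 :: p ∉ pathsFrom 0 := by
  intro h
  simpa using h.2.1 [-1] (by simp)

lemma cons_mem_image_cons {a b : ℤ} {p : List ℤ} {s : Set (List ℤ)} :
    a :: p ∈ List.cons b '' s ↔ a = b ∧ p ∈ s := by
  simp only [Set.mem_image, List.cons.injEq]
  grind

lemma pathsFrom_zero_eq : pathsFrom 0 =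
    {[]} ∪ (List.cons 0 '' pathsFrom 0 ∪ List.cons 1 '' pathsFromAfterUp 1) := by
  ext p
  cases p with
  | nil => simp [nil_mem_pathsFrom]
  | cons a p =>
    by_cases ha : a = 1 ∨ a = -1 ∨ a = 0
    · rcases ha with rfl | rfl | rfl
      · simp [cons_mem_pathsFrom (h := 0) (k := 1), pathsFromAfterUp]
      · simp [neg_one_cons_notMem_pathsFrom_zero]
      · rw [cons_mem_pathsFrom (h := 0) (k := 0) (by simp), uuFree_cons (by simp)]
        simpa using fun h => h.2.2.2
    · have hp {h : ℕ} : a :: p ∉ pathsFrom h := fun hp => ha (hp.1 a (by simp))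
      push Not at ha
      simp [hp, cons_mem_image_cons, ha, -Set.mem_image]

lemma pathsFrom_succ_eq (h : ℕ) : pathsFrom (h + 1) =
    List.cons 0 '' pathsFrom (h + 1) ∪ (List.cons (-1) '' pathsFrom h ∪
      List.cons 1 '' pathsFromAfterUp (h + 2)) := by
  ext p
  cases p with
  | nil => simp [nil_mem_pathsFrom]
  | cons a p =>
    by_cases ha : a = 1 ∨ a = -1 ∨ a = 0
    · rcases ha with rfl | rfl | rfl
      · rw [cons_mem_pathsFrom (h := h + 1) (k := h + 2) (by push_cast; ring)]
        simp [pathsFromAfterUp]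
      · rw [cons_mem_pathsFrom (h := h + 1) (k := h) (by simp), uuFree_cons (by simp)]
        simpa using fun h => h.2.2.2
      · rw [cons_mem_pathsFrom (h := h + 1) (k := h + 1) (by simp), uuFree_cons (by simp)]
        simpa using fun h => h.2.2.2
    · have hp {h : ℕ} : a :: p ∉ pathsFrom h := fun hp => ha (hp.1 a (by simp))
      push Not at ha
      simp [hp, cons_mem_image_cons, ha, -Set.mem_image]

lemma pathsFromAfterUp_succ_eq (h : ℕ) : pathsFromAfterUp (h + 1) =
    List.cons 0 '' pathsFrom (h + 1) ∪ List.cons (-1) '' pathsFrom h := by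
  ext p
  cases p with
  | nil => simp [pathsFromAfterUp, nil_mem_pathsFrom]
  | cons a p =>
    rw [pathsFromAfterUp, Set.mem_ofPred_eq, uuFree_one_cons_cons,
      Set.ext_iff.1 (pathsFrom_succ_eq h)]
    have h0 : p ∈ pathsFrom (h + 1) → UUFree (0 :: p) :=
      fun hp => (uuFree_cons (by simp)).2 hp.2.2.2
    have h1 : p ∈ pathsFrom h → UUFree (-1 :: p) :=
      fun hp => (uuFree_cons (by simp)).2 hp.2.2.2
    simp only [Set.mem_union, cons_mem_image_cons]
    grind

/-- The generating series of `pathsFrom h` by length. -/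
noncomputable def pathSeries (h : ℕ) : ℤ⟦X⟧ := genSeries List.length (pathsFrom h)

lemma genSeries_cons (a : ℤ) (s : Set (List ℤ)) :
    genSeries List.length (List.cons a '' s) = X * genSeries List.length s :=
  genSeries_image List.cons_injective (fun _ => rfl) s

lemma disjoint_image_cons {a b : ℤ} (h : a ≠ b) (s t : Set (List ℤ)) :
    Disjoint (List.cons a '' s) (List.cons b '' t) := by
  rw [Set.disjoint_left]
  rintro _ ⟨p, -, rfl⟩ ⟨q, -, hq⟩
  simp at hq
  exact h hq.1.symm

lemma genSeries_pathsFromAfterUp (h : ℕ) :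
    genSeries List.length (pathsFromAfterUp (h + 1)) =
      X * pathSeries (h + 1) + X * pathSeries h := by
  have hf : FiniteFibers List.length (pathsFromAfterUp (h + 1)) :=
    (finiteFibers_pathsFrom (h + 1)).mono fun _ hp => hp.1
  rw [pathsFromAfterUp_succ_eq] at hf ⊢
  rw [genSeries_union hf (disjoint_image_cons (by simp) _ _), genSeries_cons, genSeries_cons,
    pathSeries, pathSeries]

lemma pathSeries_zero : pathSeries 0 =
    1 + X * pathSeries 0 + X ^ 2 * (pathSeries 1 + pathSeries 0) := by
  have hf := finiteFibers_pathsFrom 0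
  have h1 := genSeries_pathsFromAfterUp 0
  conv_lhs => rw [pathSeries, pathsFrom_zero_eq]
  rw [pathsFrom_zero_eq] at hf
  rw [genSeries_union hf (by simp), genSeries_union (hf.mono Set.subset_union_right)
    (disjoint_image_cons (by simp) _ _), genSeries_cons, genSeries_cons,
    genSeries_singleton (by simp), h1, ← pathSeries]
  ring

lemma pathSeries_succ (h : ℕ) : pathSeries (h + 1) =
    X * pathSeries (h + 1) + X * pathSeries h +
      X ^ 2 * (pathSeries (h + 2) + pathSeries (h + 1)) := by
  have hf := finiteFibers_pathsFrom (h + 1)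
  have h1 := genSeries_pathsFromAfterUp (h + 1)
  conv_lhs => rw [pathSeries, pathsFrom_succ_eq]
  rw [pathsFrom_succ_eq] at hf
  rw [genSeries_union hf, genSeries_union (hf.mono Set.subset_union_right)
    (disjoint_image_cons (by simp) _ _), genSeries_cons, genSeries_cons, genSeries_cons, h1,
    ← pathSeries, ← pathSeries]
  · ring
  · exact Set.disjoint_union_right.2
      ⟨disjoint_image_cons (by simp) _ _, disjoint_image_cons (by simp) _ _⟩

lemma eq_zero_of_pathSeries_recursion (f : ℕ → ℤ⟦X⟧)
    (h0 : f 0 = X * f 0 + X ^ 2 * (f 1 + f 0))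
    (hs : ∀ h, f (h + 1) = X * f (h + 1) + X * f h + X ^ 2 * (f (h + 2) + f (h + 1))) (h : ℕ) :
    f h = 0 := by
  have hdvd (n : ℕ) : ∀ h, X ^ n ∣ f h := by
    induction n with
    | zero => simp
    | succ n ih =>
      intro h
      have hX : ∃ g, X ^ n ∣ g ∧ f h = X * g := by
        cases h with
        | zero =>
          exact ⟨f 0 + X * (f 1 + f 0),
            dvd_add (ih 0) (((ih 1).add (ih 0)).mul_left X), by linear_combination h0⟩
        | succ h =>
          exact ⟨f (h + 1) + f h + X * (f (h + 2) + f (h + 1)),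
            dvd_add ((ih _).add (ih _)) (((ih _).add (ih _)).mul_left X),
            by linear_combination hs h⟩
      obtain ⟨g, hg, hfg⟩ := hX
      rw [hfg, pow_succ']
      exact mul_dvd_mul_left X hg
  ext n
  exact X_pow_dvd_iff.1 (hdvd (n + 1) h) n n.lt_succ_self

lemma pathSeries_zero_eq : pathSeries 0 = BinaryTree.series BinaryTree.classD := by
  set d := BinaryTree.series BinaryTree.classD
  have hd : d = 1 + X * d + X ^ 2 * (1 + X * d) * d := BinaryTree.series_classD_eq
  have key := eq_zero_of_pathSeries_recursion (fun h => pathSeries h - d * (X * d) ^ h)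
    (by linear_combination pathSeries_zero - hd)
    (fun h => by linear_combination pathSeries_succ h - (X * d) ^ (h + 1) * hd) 0
  simpa [sub_eq_zero] using key

end MotzkinSeries

/-- The number of 213-avoiding double simsun permutations in `S_n` equals the
`n`-th secondary structure number, i.e. the number of Motzkin paths of length
`n` with no two consecutive up steps. -/
theorem card_doubleSimsun_avoid213_eq_secondary (n : ℕ) :
    Nat.card {σ : Equiv.Perm (Fin n) // DoubleSimsun σ ∧ Avoids213 σ} =
      Nat.card {p : List ℤ // p.length = n ∧ MotzkinPath p ∧ UUFree p} := by
  rw [card_doubleSimsun_avoids213]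
  have h := congrArg (coeff n) pathSeries_zero_eq
  simp only [pathSeries, genSeries, coeff_mk, Nat.cast_inj] at h
  rw [show {t : BinaryTree Unit | t.NoDoubleDescents ∧ t.numNodes = n} =
    {t | t ∈ BinaryTree.classD ∧ t.numNodes = n} from rfl, ← h, ← Nat.card_coe_set_eq]
  refine Nat.card_congr (Equiv.subtypeEquivRight fun p => ?_)
  simp [pathsFrom, MotzkinPath]
  tauto
end
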